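/- Let T = Alt₆, let k ≥ 1, and let y ∈ Aut(T) be such that A = ⟨Inn(T), y⟩ is isomorphic to Sym₆ (the copy of Sym₆ inside Aut(Alt₆)). Let N = T^k be the direct product of k copies of T, identified with Inn(N) ≤ Aut(N), let x ∈ Aut(N) be defined by x(t₁,…,t_k) = (y(t_k), t₁, …, t_{k−1}), and set G = ⟨N, x⟩ ≤ Aut(N). Then s(G) = 2, and u(G) = 0 if k = 1 while u(G) = 1 if k ≥ 2. -/

import Mathlib

/-- `SubSpreadGE G n` for a subgroup `G` of `X`: for any `n` nontrivial
elements of `G` there is a common element `w ∈ G` generating `G` with each. -/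
def SubSpreadGE {X : Type*} [Group X] (G : Subgroup X) (n : ℕ) : Prop :=
  ∀ a : Fin n → X, (∀ i, a i ∈ G) → (∀ i, a i ≠ 1) →
    ∃ w ∈ G, ∀ i, Subgroup.closure {a i, w} = G

/-- `SubUniformSpreadGE G n`: some conjugacy class of `G` (of an element `c`)
witnesses `u(G) ≥ n`. -/
def SubUniformSpreadGE {X : Type*} [Group X] (G : Subgroup X) (n : ℕ) : Prop :=
  ∃ c ∈ G, ∀ a : Fin n → X, (∀ i, a i ∈ G) → (∀ i, a i ≠ 1) →
    ∃ w, (∃ g ∈ G, w = g⁻¹ * c * g) ∧ ∀ i, Subgroup.closure {a i, w} = G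

namespace S6

/-- Octal code of a permutation of six points. -/
def enc (σ : Equiv.Perm (Fin 6)) : ℕ := ∑ i : Fin 6, (σ i).val * 8 ^ i.val

/-- The image of the point `i` under the permutation with code `c`. -/
def dig (c i : ℕ) : ℕ := c / 8 ^ i % 8

/-- Multiplication of permutations, on codes. -/
def mulc (c d : ℕ) : ℕ :=
  dig c (dig d 0) + dig c (dig d 1) * 8 + dig c (dig d 2) * 64 + dig c (dig d 3) * 512 +
    dig c (dig d 4) * 4096 + dig c (dig d 5) * 32768

/-- The code of `g * x * g⁻¹`, in terms of codes. -/
def conjc (g x : ℕ) : ℕ :=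
  dig g (dig x 0) * 8 ^ dig g 0 + dig g (dig x 1) * 8 ^ dig g 1 +
  dig g (dig x 2) * 8 ^ dig g 2 + dig g (dig x 3) * 8 ^ dig g 3 +
  dig g (dig x 4) * 8 ^ dig g 4 + dig g (dig x 5) * 8 ^ dig g 5

theorem dig_enc (σ : Equiv.Perm (Fin 6)) (i : Fin 6) : dig (enc σ) i.val = (σ i).val := by
  have h0 := (σ 0).isLt
  have h1 := (σ 1).isLt
  have h2 := (σ 2).isLt
  have h3 := (σ 3).isLt
  have h4 := (σ 4).isLt
  have h5 := (σ 5).isLt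
  fin_cases i <;> simp [dig, enc, Fin.sum_univ_six] <;> omega

theorem enc_injective : Function.Injective enc := by
  intro σ τ h
  ext i
  rw [← dig_enc, ← dig_enc, h]

theorem mulc_enc (σ τ : Equiv.Perm (Fin 6)) : mulc (enc σ) (enc τ) = enc (σ * τ) := by
  have e : ∀ i : Fin 6, dig (enc σ) (dig (enc τ) i.val) = ((σ * τ) i).val := fun i => by
    rw [dig_enc τ, dig_enc σ]; rfl
  have h0 := e 0
  have h1 := e 1
  have h2 := e 2
  have h3 := e 3
  have h4 := e 4
  have h5 := e 5
  simp only [Fin.val_zero, Fin.val_one, Fin.val_two, Fin.isValue,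
    show (3 : Fin 6).val = 3 from rfl, show (4 : Fin 6).val = 4 from rfl,
    show (5 : Fin 6).val = 5 from rfl] at h0 h1 h2 h3 h4 h5
  rw [mulc, h0, h1, h2, h3, h4, h5, enc, Fin.sum_univ_six]
  simp

theorem conjc_enc (g x : Equiv.Perm (Fin 6)) : conjc (enc g) (enc x) = enc (g * x * g⁻¹) := by
  have e : ∀ i : Fin 6, dig (enc g) (dig (enc x) i.val) * 8 ^ dig (enc g) i.val =
      (((g * x * g⁻¹) (g i)).val * 8 ^ (g i).val) := fun i => by
    rw [dig_enc x, dig_enc g, dig_enc g]; simp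
  have h : enc (g * x * g⁻¹) = ∑ i : Fin 6, ((g * x * g⁻¹) (g i)).val * 8 ^ (g i).val :=
    (Equiv.sum_comp g fun i => ((g * x * g⁻¹) i).val * 8 ^ i.val).symm
  rw [h, Fin.sum_univ_six, conjc, ← e, ← e, ← e, ← e, ← e, ← e]
  rfl

/-- Codes of all injective words of length `n` avoiding the letters in `used`. -/
def codesFrom : ℕ → List ℕ → List ℕ
  | 0, _ => [0]
  | n + 1, used => ((List.range 6).filter fun a => !used.contains a).flatMap fun a =>
      (codesFrom n (a :: used)).map fun c => a + 8 * c

/-- The codes of all permutations. -/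
def codes : List ℕ := codesFrom 6 []

/-- The parity of the number of inversions. -/
def invParity (c : ℕ) : ℕ :=
  let lt := fun i j => bif Nat.ble (dig c j) (dig c i) then 1 else 0
  (lt 0 1 + lt 0 2 + lt 0 3 + lt 0 4 + lt 0 5 + lt 1 2 + lt 1 3 + lt 1 4 + lt 1 5 +
    lt 2 3 + lt 2 4 + lt 2 5 + lt 3 4 + lt 3 5 + lt 4 5) % 2

/-- The codes of the even permutations. -/
def evens : List ℕ := codes.filter fun c => Nat.beq (invParity c) 0

theorem enc_mem_codes (σ : Equiv.Perm (Fin 6)) : enc σ ∈ codes := by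
  have hne : ∀ i j : Fin 6, i ≠ j → (σ i).val ≠ (σ j).val := fun i j h e =>
    h (σ.injective (Fin.ext e))
  have key : ∀ a : Fin 6, (σ a).val ∈ List.range 6 := fun a => List.mem_range.2 (σ a).isLt
  have hc : enc σ = (σ 0).val + 8 * ((σ 1).val + 8 * ((σ 2).val + 8 * ((σ 3).val +
      8 * ((σ 4).val + 8 * ((σ 5).val + 8 * 0))))) := by
    simp [enc, Fin.sum_univ_six]; ring
  rw [hc, codes]
  simp only [codesFrom, List.mem_flatMap, List.mem_map, List.mem_filter]
  refine ⟨_, ⟨key 0, ?_⟩, _, ⟨_, ⟨key 1, ?_⟩, _, ⟨_, ⟨key 2, ?_⟩, _, ⟨_, ⟨key 3, ?_⟩, _,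
    ⟨_, ⟨key 4, ?_⟩, _, ⟨_, ⟨key 5, ?_⟩, 0, by simp, rfl⟩, rfl⟩, rfl⟩, rfl⟩, rfl⟩, rfl⟩ <;>
  simp [hne]

theorem sign_eq (σ : Equiv.Perm (Fin 6)) :
    Equiv.Perm.sign σ = if invParity (enc σ) = 0 then 1 else -1 := by
  have e : ∀ i j : Fin 6, i ≠ j → (if σ i < σ j then (1 : ℤˣ) else -1) =
      (-1) ^ (bif Nat.ble (dig (enc σ) j.val) (dig (enc σ) i.val) then 1 else 0) := by
    intro i j hij
    have hne : (σ i).val ≠ (σ j).val := fun h => hij (σ.injective (Fin.ext h))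
    rw [dig_enc, dig_enc]
    by_cases h : σ i < σ j
    · have h' : Nat.ble (σ j).val (σ i).val = false := by
        rw [Bool.eq_false_iff, Ne, Nat.ble_eq]; rw [Fin.lt_def] at h; omega
      simp [h, h']
    · have h' : Nat.ble (σ j).val (σ i).val = true := by
        rw [Nat.ble_eq]; rw [Fin.lt_def] at h; omega
      simp [h, h']
  have hmod : ∀ n : ℕ, (if n % 2 = 0 then (1 : ℤˣ) else -1) = (-1) ^ n := fun n => by
    rcases Nat.mod_two_eq_zero_or_one n with h | h
    · rw [if_pos h, (Nat.even_iff.2 h).neg_one_pow]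
    · rw [if_neg (by omega), (Nat.odd_iff.2 h).neg_one_pow]
  rw [invParity, hmod, Equiv.Perm.sign_eq_prod_prod_Ioi, Fin.prod_univ_six,
    show Finset.Ioi (0 : Fin 6) = {1, 2, 3, 4, 5} by decide,
    show Finset.Ioi (1 : Fin 6) = {2, 3, 4, 5} by decide,
    show Finset.Ioi (2 : Fin 6) = {3, 4, 5} by decide,
    show Finset.Ioi (3 : Fin 6) = {4, 5} by decide,
    show Finset.Ioi (4 : Fin 6) = {5} by decide,
    show Finset.Ioi (5 : Fin 6) = ∅ by decide]
  simp only [Finset.prod_insert, Finset.mem_insert, Finset.mem_singleton, Finset.prod_singleton,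
    Fin.reduceEq, or_self, not_false_eq_true, Finset.prod_empty, mul_one]
  rw [e 0 1, e 0 2, e 0 3, e 0 4, e 0 5, e 1 2, e 1 3, e 1 4, e 1 5, e 2 3, e 2 4, e 2 5, e 3 4,
    e 3 5, e 4 5] <;> first | decide | skip
  simp only [pow_add, mul_assoc]
  rfl

theorem exists_enc_eq {c : ℕ} (h : c ∈ codes) : ∃ σ, enc σ = c := by
  have hsub : Finset.univ.image enc ⊆ codes.toFinset := fun c hc => by
    obtain ⟨σ, -, rfl⟩ := Finset.mem_image.1 hc
    exact List.mem_toFinset.2 (enc_mem_codes σ)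
  have hlen : codes.length = 720 := by decide +kernel
  have hcard : (Finset.univ.image enc).card = 720 := by
    rw [Finset.card_image_of_injective _ enc_injective, Finset.card_univ, Fintype.card_perm]
    rfl
  have := Finset.eq_of_subset_of_card_le hsub
    (by rw [hcard, ← hlen]; exact List.toFinset_card_le _)
  have hc : c ∈ Finset.univ.image enc := by rw [this]; exact List.mem_toFinset.2 h
  obtain ⟨σ, -, h⟩ := Finset.mem_image.1 hc
  exact ⟨σ, h⟩

theorem enc_mem_evens {σ : Equiv.Perm (Fin 6)} (h : Equiv.Perm.sign σ = 1) : enc σ ∈ evens := by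
  refine List.mem_filter.2 ⟨enc_mem_codes σ, ?_⟩
  rw [sign_eq] at h
  split_ifs at h with h'
  · simp [h']
  · exact absurd h (by decide)

theorem exists_even {c : ℕ} (h : c ∈ evens) : ∃ σ, Equiv.Perm.sign σ = 1 ∧ enc σ = c := by
  obtain ⟨h1, h2⟩ := List.mem_filter.1 h
  obtain ⟨σ, rfl⟩ := exists_enc_eq h1
  refine ⟨σ, ?_, rfl⟩
  rw [sign_eq, if_pos (Nat.eq_of_beq_eq_true h2)]

/-- Code of the identity. -/
def idc : ℕ := 181896
/-- Code of the permutation `(0 1 2)(3 4)`. -/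
def vc : ℕ := 178193
/-- Code of the square of `(0 1 2)(3 4)`. -/
def vvc : ℕ := 181826

/-- The order of the permutation with code `c`. -/
def ordc (c : ℕ) : ℕ :=
  let c2 := mulc c c
  let c3 := mulc c2 c
  bif Nat.beq c idc then 1 else bif Nat.beq c2 idc then 2 else bif Nat.beq c3 idc then 3 else
    bif Nat.beq (mulc c2 c2) idc then 4 else bif Nat.beq (mulc c2 c3) idc then 5 else 6

/-- The orders of `c`, `c * v` and `c * v ^ 2`, combined in one number. -/
def invc (c : ℕ) : ℕ := ordc c * 64 + ordc (mulc c vc) * 8 + ordc (mulc c vvc)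

/-- Whether the permutation with code `c` has prime order. -/
def primec (c : ℕ) : Bool :=
  let c2 := mulc c c
  let c3 := mulc c2 c
  !Nat.beq c idc && (Nat.beq c2 idc || Nat.beq c3 idc || Nat.beq (mulc c2 c3) idc)

/-- The number of fixed points. -/
def fixc (c : ℕ) : ℕ :=
  (bif Nat.beq (dig c 0) 0 then 1 else 0) + (bif Nat.beq (dig c 1) 1 then 1 else 0) +
  (bif Nat.beq (dig c 2) 2 then 1 else 0) + (bif Nat.beq (dig c 3) 3 then 1 else 0) +
  (bif Nat.beq (dig c 4) 4 then 1 else 0) + (bif Nat.beq (dig c 5) 5 then 1 else 0)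

/-- Membership in the subset of `{0, …, 5}` with bit mask `S`. -/
def tb (S i : ℕ) : Bool := Nat.beq (S / 2 ^ i % 2) 1

/-- The bit mask of a subset of `{0, …, 5}`. -/
def mask (f : ℕ → Bool) : ℕ :=
  (bif f 0 then 1 else 0) + (bif f 1 then 2 else 0) + (bif f 2 then 4 else 0) +
  (bif f 3 then 8 else 0) + (bif f 4 then 16 else 0) + (bif f 5 then 32 else 0)

def any6 (f : ℕ → Bool) : Bool := f 0 || f 1 || f 2 || f 3 || f 4 || f 5

def all6 (f : ℕ → Bool) : Bool := f 0 && f 1 && f 2 && f 3 && f 4 && f 5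

/-- Enlarge `S` by its preimage under `h` when the two sets meet. -/
def step (S h : ℕ) : ℕ :=
  bif any6 fun j => tb S j && tb S (dig h j) then mask fun j => tb S j || tb S (dig h j) else S

/-- Enlarge `S` by the permutations in `hs`, one after the other. -/
def spread (S : ℕ) (hs : List ℕ) : ℕ := hs.foldl step S

/-- A sufficient condition for `t` and `v = (0 1 2)(3 4)` to generate the symmetric group: the
transposition `v ^ 3` of `3` and `4` yields all others by conjugation. -/
def goodc (t : ℕ) : Bool :=
  let tt := mulc t t
  let w := mulc t (mulc vc t)
  Nat.beq (spread 24 [t, vc, tt, w, t, vc, tt, w]) 63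

/-- The bit mask of the set of moved points. -/
def movedc (c : ℕ) : ℕ := mask fun j => !Nat.beq (dig c j) j

/-- `c` preserves the partition of `{0, …, 5}` into the set with mask `S` and its complement. -/
def presc (S c : ℕ) : Bool :=
  all6 fun j => Bool.xor (tb S 0) (tb S j) == Bool.xor (tb S (dig c 0)) (tb S (dig c j))

/-- `x` and `w` preserve a common partition of `{0, …, 5}` into two nonempty sets. -/
def badc (x w : ℕ) : Bool :=
  ((List.range 31).filter fun S => presc (S + 1) x).any fun S => presc (S + 1) w

def mem (c : ℕ) (l : List ℕ) : Bool := l.any fun d => Nat.beq c d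

/-- Odd permutations without fixed points, other than involutions, are the six-cycles. -/
def isSix (c : ℕ) : Bool :=
  Nat.beq (invParity c) 1 && Nat.beq (fixc c) 0 && !Nat.beq (mulc c c) idc

/-- The number of fixed points and the order, combined in one number. -/
def typc (c : ℕ) : ℕ := fixc c * 8 + ordc c

def primes : List ℕ := codes.filter primec

def cnt (i : ℕ) (l : List ℕ) : ℕ := l.countP fun j => Nat.beq i j

/-- The conjugates of `r` by even permutations. -/
def orbit (r : ℕ) : List ℕ := evens.map fun u => conjc u r

/-- Representatives of the even conjugacy classes of elements of prime order. -/
def reps : List ℕ := [181889, 181441, 152769, 181777, 120849, 166097, 176401]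

/-- For each type of elements of prime order: the type, the order of the centralizer in the
alternating group, and a bound on the number of conjugators to a non-generating conjugate. -/
def typeTable : List (ℕ × ℕ × ℕ) :=
  [(34, 24, 360), (18, 8, 216), (2, 24, 216), (27, 9, 252), (3, 9, 36), (13, 5, 120)]

/-- A six-cycle. -/
def sixc : ℕ := 22737

theorem bad_evens : (evens.countP fun c => !goodc c) ≤ 108 := by decide +kernel

theorem inv_fiber_good : ((evens.filter goodc).map invc).dedup.all
    (fun i => Nat.ble (cnt i (evens.map invc)) 30) = true := by
  decide +kernel

theorem type_counts : typeTable.all (fun t =>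
    let l := primes.filter fun c => Nat.beq (typc c) t.1
    let m := l.map invc
    Nat.ble ((l.countP fun c => !goodc c) * t.2.1) t.2.2 &&
      m.dedup.all fun i => Nat.ble (cnt i m * t.2.1) 179) = true := by
  decide +kernel

theorem centralizers : reps.all (fun r => typeTable.any fun t => Nat.beq (typc r) t.1 &&
    Nat.beq (evens.countP fun u => Nat.beq (mulc u r) (mulc r u)) t.2.1) = true := by
  decide +kernel

theorem prime_reps : primes.all (fun c =>
    reps.any fun r => Nat.beq (typc r) (typc c) && mem c (orbit r)) = true := by
  decide +kernel

theorem good_pairs :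
    ([(181441, 18), (181441, 2), (152769, 2), (181777, 2)] : List (ℕ × ℕ)).all (fun p =>
      primes.all fun c => !Nat.beq (typc c) p.2 ||
        evens.any fun u => goodc (conjc u p.1) && goodc (conjc u c)) = true := by
  decide +kernel

theorem good_inv_ne_swap : primes.all (fun c =>
    !(mem (invc c) ((primes.filter fun d => Nat.beq (fixc d) 4).map invc) && goodc c)) = true := by
  decide +kernel

theorem swap_triple : primes.all (fun c => !Nat.beq (typc c) 2 ||
    ((evens.any fun u => Nat.beq (conjc u 181889) 117384 && goodc (conjc u c) &&
        Nat.beq (invc (conjc u c)) 174) &&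
      evens.any fun u => Nat.beq (conjc u 181889) 180363 &&
        !Nat.beq (invc (conjc u c)) 174)) = true := by
  decide +kernel

theorem swap_swap :
    (Nat.beq (spread 24 [117384, 180363, vc, 117384, 180363, vc, 117384, 180363]) 63 &&
    !Nat.beq (invc 117384) (invc 180363)) = true := by
  decide +kernel

theorem swap_triple_five : primes.all (fun c => !Nat.beq (typc c) 2 || evens.any fun w =>
    let w2 := mulc w w
    let cw := mulc c w
    let z := mulc cw (mulc cw cw)
    Nat.beq (fixc z) 4 && Nat.beq (spread (movedc z) [w, w2, c, w, w2, c]) 63 &&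
      Nat.beq (spread 3 [w, w2, w, w2]) 63) = true := by
  decide +kernel

theorem bad_odds : codes.all (fun w => Nat.beq (invParity w) 0 || isSix w ||
    (badc 181889 w && (badc 181777 w || badc 120968 w) &&
      (badc 152776 w || badc 153168 w || badc 152216 w) &&
      (badc 152776 w || badc 165460 w || badc 17053 w))) = true := by
  decide +kernel

theorem six_orbit : codes.all (fun c => !isSix c || mem c (orbit sixc)) = true := by
  decide +kernel

open Equiv.Perm Subgroup

/-- The permutation `(0 1 2)(3 4)`. -/
def v : Equiv.Perm (Fin 6) := Equiv.swap 0 1 * Equiv.swap 1 2 * Equiv.swap 3 4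

theorem enc_v : enc v = vc := by decide +kernel
theorem enc_vv : enc (v ^ 2) = vvc := by decide +kernel
theorem enc_one : enc 1 = idc := by decide +kernel
theorem sign_v : sign v = -1 := by decide +kernel
theorem v_pow_three : v ^ 3 = Equiv.swap 3 4 := by decide +kernel

theorem beq_idc (σ : Equiv.Perm (Fin 6)) : Nat.beq (enc σ) idc = true ↔ σ = 1 := by
  rw [Nat.beq_eq, ← enc_one, enc_injective.eq_iff]

theorem ordc_cases (σ : Equiv.Perm (Fin 6)) : ordc (enc σ) =
    if σ = 1 then 1 else if σ ^ 2 = 1 then 2 else if σ ^ 3 = 1 then 3 else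
      if σ ^ 4 = 1 then 4 else if σ ^ 5 = 1 then 5 else 6 := by
  simp only [ordc, mulc_enc, cond_eq_ite, beq_idc]
  rw [← pow_two, show σ ^ 2 * σ = σ ^ 3 from (pow_succ σ 2).symm,
    show σ ^ 2 * σ ^ 2 = σ ^ 4 by group, show σ ^ 2 * σ ^ 3 = σ ^ 5 by group]

theorem ordc_congr {σ τ : Equiv.Perm (Fin 6)} (h : ∀ n : ℕ, σ ^ n = 1 ↔ τ ^ n = 1) :
    ordc (enc σ) = ordc (enc τ) := by
  have h1 := h 1
  rw [pow_one, pow_one] at h1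
  simp only [ordc_cases, h, h1]

/-- `σ` and `τ` are distinguished by the orders of the elements `σ * v ^ j`, `τ * v ^ j`. -/
def Sep (v σ τ : Equiv.Perm (Fin 6)) : Prop :=
  ∃ j n : ℕ, ¬((σ * v ^ j) ^ n = 1 ↔ (τ * v ^ j) ^ n = 1)

def inv3 (σ : Equiv.Perm (Fin 6)) : ℕ := invc (enc σ)

theorem sep_of_inv3_ne {σ τ : Equiv.Perm (Fin 6)} (h : inv3 σ ≠ inv3 τ) : Sep v σ τ := by
  by_contra hn
  simp only [Sep, not_exists, not_not] at hn
  apply h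
  have h0 := ordc_congr (fun n => hn 0 n)
  have h1 := ordc_congr (fun n => hn 1 n)
  have h2 := ordc_congr (fun n => hn 2 n)
  rw [pow_zero, mul_one, mul_one] at h0
  rw [pow_one] at h1
  simp only [inv3, invc]
  rw [← enc_v, ← enc_vv, mulc_enc, mulc_enc, mulc_enc, mulc_enc, h0, h1, h2]

/-! ### Generation certificates -/

/-- `H` contains all transpositions of points in the set with mask `S`. -/
def Linked (H : Subgroup (Equiv.Perm (Fin 6))) (S : ℕ) : Prop :=
  ∀ i j : Fin 6, tb S i.val = true → tb S j.val = true → Equiv.swap i j ∈ H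

theorem tb_mask (f : ℕ → Bool) (i : Fin 6) : tb (mask f) i.val = f i.val := by
  have key : ∀ a b c d e g : Bool,
      let m := (bif a then 1 else 0) + (bif b then 2 else 0) + (bif c then 4 else 0) +
        (bif d then 8 else 0) + (bif e then 16 else 0) + (bif g then 32 else 0)
      tb m 0 = a ∧ tb m 1 = b ∧ tb m 2 = c ∧ tb m 3 = d ∧ tb m 4 = e ∧ tb m 5 = g := by decide
  obtain ⟨h0, h1, h2, h3, h4, h5⟩ := key (f 0) (f 1) (f 2) (f 3) (f 4) (f 5)
  fin_cases i <;> assumption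

theorem any6_iff (f : ℕ → Bool) : any6 f = true ↔ ∃ i : Fin 6, f i.val = true := by
  simp [any6, Fin.exists_fin_succ, or_assoc]

theorem all6_iff (f : ℕ → Bool) : all6 f = true ↔ ∀ i : Fin 6, f i.val = true := by
  simp [all6, Fin.forall_fin_succ, and_assoc]

theorem Linked.step {H : Subgroup (Equiv.Perm (Fin 6))} {S : ℕ} (hS : Linked H S)
    {h : Equiv.Perm (Fin 6)} (hh : h ∈ H) : Linked H (step S (enc h)) := by
  unfold S6.step
  rcases e : any6 fun j => tb S j && tb S (dig (enc h) j) with _ | _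
  · exact hS
  obtain ⟨j₀, hj₀⟩ := (any6_iff _).1 e
  rw [Bool.and_eq_true, dig_enc] at hj₀
  have key : ∀ i : Fin 6, (tb S i.val || tb S (dig (enc h) i.val)) = true →
      Equiv.swap i j₀ ∈ H := by
    intro i hi
    rw [Bool.or_eq_true, dig_enc] at hi
    rcases hi with hi | hi
    · exact hS i j₀ hi hj₀.1
    · have := H.mul_mem (H.mul_mem (H.inv_mem hh) (hS _ _ hi hj₀.2)) hh
      rwa [Equiv.swap_apply_apply, ← mul_assoc, ← mul_assoc, inv_mul_cancel, one_mul,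
        mul_assoc, inv_mul_cancel, mul_one] at this
  intro i j hi hj
  rw [cond_true, tb_mask] at hi hj
  have hi' := key i hi
  have hj' := key j hj
  by_cases hij : i = j
  · rw [hij, Equiv.swap_self]; exact H.one_mem
  by_cases hjj : j = j₀
  · rwa [hjj]
  have := H.mul_mem (H.mul_mem hi' hj') hi'
  rwa [Equiv.swap_comm i j₀, Equiv.swap_mul_swap_mul_swap hjj (Ne.symm hij)] at this

theorem Linked.spread {H : Subgroup (Equiv.Perm (Fin 6))} {S : ℕ} (hS : Linked H S)
    (hs : List (Equiv.Perm (Fin 6))) (hh : ∀ h ∈ hs, h ∈ H) :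
    Linked H (spread S (hs.map enc)) := by
  induction hs generalizing S with
  | nil => exact hS
  | cons a l ih =>
    exact ih (hS.step (hh a (by simp))) fun h hl => hh h (by simp [hl])

theorem Linked.eq_top {H : Subgroup (Equiv.Perm (Fin 6))} (h : Linked H 63) : H = ⊤ := by
  rw [eq_top_iff, ← closure_isSwap, closure_le]
  rintro σ ⟨i, j, -, rfl⟩
  have : ∀ i : Fin 6, tb 63 i.val = true := by decide
  exact h i j (this i) (this j)

theorem linked_swap {H : Subgroup (Equiv.Perm (Fin 6))} {i j : Fin 6} (h : Equiv.swap i j ∈ H)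
    {S : ℕ} (hS : ∀ l : Fin 6, tb S l.val = true → l = i ∨ l = j) : Linked H S := by
  intro a b ha hb
  rcases hS a ha with rfl | rfl <;> rcases hS b hb with rfl | rfl
  · rw [Equiv.swap_self]; exact H.one_mem
  · exact h
  · rwa [Equiv.swap_comm]
  · rw [Equiv.swap_self]; exact H.one_mem

theorem linked_v {H : Subgroup (Equiv.Perm (Fin 6))} (h : v ∈ H) : Linked H 24 := by
  apply linked_swap (i := 3) (j := 4) (v_pow_three ▸ H.pow_mem h 3)
  decide

def Good (σ : Equiv.Perm (Fin 6)) : Prop := goodc (enc σ) = true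

theorem Good.closure_eq {σ : Equiv.Perm (Fin 6)} (h : Good σ) : closure {v, σ} = ⊤ := by
  have hv : v ∈ closure {v, σ} := subset_closure (by simp)
  have hσ : σ ∈ closure {v, σ} := subset_closure (by simp)
  have := (linked_v hv).spread
    [σ, v, σ * σ, σ * (v * σ), σ, v, σ * σ, σ * (v * σ)] (by
      simp [hv, hσ, mul_mem])
  unfold Good goodc at h
  simp only [← enc_v, mulc_enc, Nat.beq_eq] at h
  simp only [List.map_cons, List.map_nil, h] at this
  exact this.eq_top

/-! ### Partition certificates -/

theorem closure_ne_top_of_badc {x w : Equiv.Perm (Fin 6)} (h : badc (enc x) (enc w) = true) :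
    closure {x, w} ≠ ⊤ := by
  simp only [badc, List.any_eq_true, List.mem_filter, List.mem_range] at h
  obtain ⟨S, ⟨hS, hx⟩, hw⟩ := h
  have hp : ∀ σ, presc (S + 1) (enc σ) = true → ∀ j : Fin 6,
      Bool.xor (tb (S + 1) 0) (tb (S + 1) j.val) =
        Bool.xor (tb (S + 1) (σ 0).val) (tb (S + 1) (σ j).val) := fun σ h j => by
    have := (all6_iff _).1 h j
    rw [beq_iff_eq, dig_enc, show (0 : ℕ) = (0 : Fin 6).val from rfl, dig_enc] at this
    exact this
  set f : Fin 6 → Bool := fun i => tb (S + 1) i.val with hf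
  have hnc : ∃ i j l : Fin 6, i ≠ j ∧ f i = f j ∧ f l ≠ f i := by
    have : ∀ S < 31, ∃ i j l : Fin 6, i ≠ j ∧ tb (S + 1) i.val = tb (S + 1) j.val ∧
      tb (S + 1) l.val ≠ tb (S + 1) i.val := by decide +kernel
    exact this S hS
  let K : Subgroup (Equiv.Perm (Fin 6)) :=
    { carrier := {σ | ∀ i j, Bool.xor (f i) (f j) = Bool.xor (f (σ i)) (f (σ j))}
      mul_mem' := fun {a b} ha hb i j => by rw [hb i j, ha (b i) (b j)]; rfl
      one_mem' := fun i j => rfl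
      inv_mem' := fun {a} ha i j => by
        have := ha (a⁻¹ i) (a⁻¹ j)
        simpa using this.symm }
  have hK : ∀ σ, presc (S + 1) (enc σ) = true → σ ∈ K := fun σ h i j => by
    have hi : Bool.xor (f 0) (f i) = Bool.xor (f (σ 0)) (f (σ i)) := hp σ h i
    have hj : Bool.xor (f 0) (f j) = Bool.xor (f (σ 0)) (f (σ j)) := hp σ h j
    revert hi hj
    rcases f 0 <;> rcases f i <;> rcases f j <;> rcases f (σ 0) <;> rcases f (σ i) <;>
      rcases f (σ j) <;> decide
  intro htop
  have hle : closure {x, w} ≤ K := by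
    rw [closure_le]
    rintro σ (rfl | rfl)
    exacts [hK _ hx, hK _ hw]
  obtain ⟨i, j, l, hij, he, hl⟩ := hnc
  have hm : Equiv.swap i l ∈ K := hle (htop ▸ mem_top _)
  have := hm i j
  have hjl : j ≠ l := fun h => hl (by rw [← h, he])
  rw [Equiv.swap_apply_left, Equiv.swap_apply_of_ne_of_ne hij.symm hjl, he] at this
  rw [he] at hl
  revert this hl
  rcases f j <;> rcases f l <;> decide

open Classical in
/-- The number of even permutations with property `P`. -/
noncomputable def evenCard (P : Equiv.Perm (Fin 6) → Prop) : ℕ :=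
  (Finset.univ.filter fun u => sign u = 1 ∧ P u).card

theorem evenCard_mono {P Q : Equiv.Perm (Fin 6) → Prop} (h : ∀ u, sign u = 1 → P u → Q u) :
    evenCard P ≤ evenCard Q := by
  classical
  refine Finset.card_le_card fun u hu => ?_
  simp only [Finset.mem_filter, Finset.mem_univ, true_and] at hu ⊢
  exact ⟨hu.1, h u hu.1 hu.2⟩

theorem evenCard_comp_le {P : Equiv.Perm (Fin 6) → Prop}
    (f : Equiv.Perm (Fin 6) → Equiv.Perm (Fin 6)) (hf : Function.Injective f)
    (hs : ∀ u, sign u = 1 → sign (f u) = 1) : evenCard (fun u => P (f u)) ≤ evenCard P := by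
  classical
  refine Finset.card_le_card_of_injOn f (fun u hu => ?_) hf.injOn
  simp only [Finset.coe_filter, Finset.mem_univ, true_and, Set.mem_ofPred_eq] at hu ⊢
  exact ⟨hs u hu.1, hu.2⟩

theorem evenCard_true : evenCard (fun _ => True) = 360 := by
  classical
  have h := two_mul_card_alternatingGroup (α := Fin 6)
  rw [Fintype.card_perm, Fintype.card_fin, Fintype.card_subtype] at h
  unfold evenCard
  simp only [and_true, ← mem_alternatingGroup]
  have h6 : Nat.factorial 6 = 720 := rfl
  rw [h6] at h
  convert (by omega :
    (Finset.univ.filter fun u : Equiv.Perm (Fin 6) => u ∈ alternatingGroup (Fin 6)).card = 360)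

theorem exists_even_avoiding {P Q : Equiv.Perm (Fin 6) → Prop}
    (h : evenCard P + evenCard Q < 360) : ∃ u, sign u = 1 ∧ ¬P u ∧ ¬Q u := by
  classical
  by_contra hn
  push Not at hn
  have : evenCard (fun _ => True) ≤ evenCard P + evenCard Q := by
    unfold evenCard
    refine le_trans (Finset.card_le_card fun u hu => ?_) (Finset.card_union_le _ _)
    simp only [Finset.mem_filter, Finset.mem_univ, true_and, Finset.mem_union, and_true] at hu ⊢
    by_cases hP : P u
    · exact Or.inl ⟨hu, hP⟩
    · exact Or.inr ⟨hu, hn u hu hP⟩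
  rw [evenCard_true] at this
  omega

theorem evenCard_or_le (P Q : Equiv.Perm (Fin 6) → Prop) :
    evenCard (fun u => P u ∨ Q u) ≤ evenCard P + evenCard Q := by
  classical
  unfold evenCard
  refine le_trans (Finset.card_le_card fun u hu => ?_) (Finset.card_union_le _ _)
  simp only [Finset.mem_filter, Finset.mem_univ, true_and, Finset.mem_union] at hu ⊢
  tauto

theorem evenCard_le_countP {P : Equiv.Perm (Fin 6) → Prop} (p : ℕ → Bool)
    (h : ∀ u, sign u = 1 → P u → p (enc u) = true) : evenCard P ≤ evens.countP p := by
  classical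
  rw [List.countP_eq_length_filter]
  refine le_trans ?_ (List.toFinset_card_le _)
  refine Finset.card_le_card_of_injOn enc (fun u hu => ?_) enc_injective.injOn
  simp only [Finset.coe_filter, Finset.mem_univ, true_and, Set.mem_ofPred_eq] at hu
  simp only [List.coe_toFinset, List.mem_filter, Set.mem_ofPred_eq]
  exact ⟨enc_mem_evens hu.1, h u hu.1 hu.2⟩

theorem evenCard_not_good : evenCard (fun u => ¬Good u) ≤ 108 :=
  le_trans (evenCard_le_countP (fun c => !goodc c) fun u _ h => by simpa [Good] using h) bad_evens

theorem evenCard_inv3_good {ρ : Equiv.Perm (Fin 6)} (hs : sign ρ = 1) (hρ : Good ρ) :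
    evenCard (fun u => inv3 u = inv3 ρ) ≤ 30 := by
  have h := List.all_eq_true.1 inv_fiber_good (inv3 ρ)
    (List.mem_dedup.2 (List.mem_map.2 ⟨enc ρ, List.mem_filter.2 ⟨enc_mem_evens hs, hρ⟩, rfl⟩))
  rw [Nat.ble_eq, cnt, List.countP_map] at h
  refine le_trans (evenCard_le_countP _ fun u _ hu => ?_) h
  simpa [inv3, Nat.beq_eq] using hu.symm

/-! ### Elements of prime order -/

def PrimeOrd (x : Equiv.Perm (Fin 6)) : Prop := x ≠ 1 ∧ (x ^ 2 = 1 ∨ x ^ 3 = 1 ∨ x ^ 5 = 1)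

theorem primec_enc (x : Equiv.Perm (Fin 6)) : primec (enc x) = true ↔ PrimeOrd x := by
  simp only [primec, mulc_enc, Bool.and_eq_true, Bool.or_eq_true, Bool.not_eq_true', PrimeOrd,
    beq_idc, ← Bool.not_eq_true]
  rw [← pow_two, show x ^ 2 * x = x ^ 3 from (pow_succ x 2).symm, ← pow_add]
  tauto

theorem PrimeOrd.mem {x : Equiv.Perm (Fin 6)} (h : PrimeOrd x) : enc x ∈ primes :=
  List.mem_filter.2 ⟨enc_mem_codes x, (primec_enc x).2 h⟩

theorem conj_pow_eq_one (h x : Equiv.Perm (Fin 6)) (n : ℕ) : (h * x * h⁻¹) ^ n = 1 ↔ x ^ n = 1 := by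
  rw [conj_pow, conj_eq_one_iff]

theorem PrimeOrd.conj {x : Equiv.Perm (Fin 6)} (hx : PrimeOrd x) (h : Equiv.Perm (Fin 6)) :
    PrimeOrd (h * x * h⁻¹) := by
  refine ⟨fun e => hx.1 ?_, ?_⟩
  · rwa [conj_eq_one_iff] at e
  · simpa only [conj_pow_eq_one] using hx.2

/-- The number of fixed points. -/
def fx (x : Equiv.Perm (Fin 6)) : ℕ := fixc (enc x)

theorem fx_eq_card (x : Equiv.Perm (Fin 6)) :
    fx x = (Finset.univ.filter fun i => x i = i).card := by
  have e : ∀ i : Fin 6, (bif Nat.beq (dig (enc x) i.val) i.val then 1 else 0) =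
      if x i = i then 1 else 0 := fun i => by
    rw [dig_enc, cond_eq_ite]; simp [Nat.beq_eq, Fin.ext_iff]
  rw [Finset.card_filter, Fin.sum_univ_six, ← e, ← e, ← e, ← e, ← e, ← e]
  rfl

theorem fx_conj (h x : Equiv.Perm (Fin 6)) : fx (h * x * h⁻¹) = fx x := by
  rw [fx_eq_card, fx_eq_card]
  refine (Finset.card_bij (fun i _ => h i) (fun i hi => ?_) (fun _ _ _ _ e => h.injective e)
    fun j hj => ⟨h⁻¹ j, ?_, by simp⟩).symm
  · rw [Finset.mem_filter] at hi ⊢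
    rw [mul_apply, mul_apply, show h⁻¹ (h i) = i from h.symm_apply_apply i, hi.2]
    exact ⟨Finset.mem_univ _, rfl⟩
  · rw [Finset.mem_filter] at hj ⊢
    refine ⟨Finset.mem_univ _, h.injective ?_⟩
    rw [show h (h⁻¹ j) = j from h.apply_symm_apply j]
    exact hj.2

def typ (x : Equiv.Perm (Fin 6)) : ℕ := typc (enc x)

theorem typ_conj (h x : Equiv.Perm (Fin 6)) : typ (h * x * h⁻¹) = typ x := by
  have h1 := fx_conj h x
  have h2 := ordc_congr (conj_pow_eq_one h x)
  simp only [fx] at h1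
  simp only [typ, typc, h1, h2]

theorem mem_iff {c : ℕ} {l : List ℕ} : mem c l = true ↔ c ∈ l := by
  simp [mem, Nat.beq_eq]

theorem exists_of_mem_orbit {x : Equiv.Perm (Fin 6)} {r : ℕ} (hr : r ∈ codes)
    (h : mem (enc x) (orbit r) = true) :
    ∃ g y, sign g = 1 ∧ enc y = r ∧ x = g * y * g⁻¹ := by
  obtain ⟨c, hc, h⟩ := List.mem_map.1 (mem_iff.1 h)
  obtain ⟨g, hg, rfl⟩ := exists_even hc
  obtain ⟨y, rfl⟩ := exists_enc_eq hr
  rw [conjc_enc] at h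
  exact ⟨g, y, hg, rfl, (enc_injective h).symm⟩

theorem reps_mem : ∀ r ∈ reps, r ∈ codes := by
  have : reps.all (fun r => mem r codes) = true := by decide +kernel
  exact fun r hr => mem_iff.1 (List.all_eq_true.1 this r hr)

theorem PrimeOrd.exists_rep {x : Equiv.Perm (Fin 6)} (hx : PrimeOrd x) :
    ∃ g y, sign g = 1 ∧ enc y ∈ reps ∧ typ y = typ x ∧ x = g * y * g⁻¹ := by
  obtain ⟨r, hr, h⟩ := List.any_eq_true.1 (List.all_eq_true.1 prime_reps _ hx.mem)
  rw [Bool.and_eq_true, Nat.beq_eq] at h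
  obtain ⟨g, y, hg, rfl, e⟩ := exists_of_mem_orbit (reps_mem r hr) h.2
  exact ⟨g, y, hg, hr, h.1, e⟩

/-- Counting conjugators by the size of the centralizer. -/
theorem PrimeOrd.exists_table {x : Equiv.Perm (Fin 6)} (hx : PrimeOrd x) :
    ∃ t ∈ typeTable, t.1 = typ x ∧ ∀ (P : Equiv.Perm (Fin 6) → Prop) (p : ℕ → Bool),
      (∀ y, P y → p (enc y) = true) → evenCard (fun u => P (u * x * u⁻¹)) ≤
        t.2.1 * (primes.filter fun c => Nat.beq (typc c) t.1).countP p := by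
  classical
  obtain ⟨h, y, hh, hy, hyt, hxy⟩ := hx.exists_rep
  obtain ⟨t, ht, e⟩ := List.any_eq_true.1 (List.all_eq_true.1 centralizers _ hy)
  rw [Bool.and_eq_true, Nat.beq_eq, Nat.beq_eq] at e
  have htx : t.1 = typ x := by rw [← e.1, ← hyt]; rfl
  refine ⟨t, ht, htx, fun P p hp => ?_⟩
  have hcent : evenCard (fun u => u * y = y * u) ≤ t.2.1 := by
    rw [← e.2]
    refine evenCard_le_countP _ fun u _ hu => ?_
    rw [mulc_enc, mulc_enc, hu, Nat.beq_eq]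
  set s := Finset.univ.filter fun u => sign u = 1 ∧ P (u * x * u⁻¹) with hs
  have h1 : (s.image fun u => enc (u * x * u⁻¹)).card ≤
      (primes.filter fun c => Nat.beq (typc c) t.1).countP p := by
    rw [List.countP_eq_length_filter]
    refine le_trans (Finset.card_le_card fun c hc => ?_) (List.toFinset_card_le _)
    obtain ⟨u, hu, rfl⟩ := Finset.mem_image.1 hc
    rw [hs, Finset.mem_filter] at hu
    rw [List.mem_toFinset, List.mem_filter, List.mem_filter, Nat.beq_eq]
    exact ⟨⟨(hx.conj u).mem, (typ_conj u x).trans htx.symm⟩, hp _ hu.2.2⟩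
  have h2 := Finset.card_le_mul_card_image (f := fun u => enc (u * x * u⁻¹)) s t.2.1 ?_
  · exact le_trans h2 (Nat.mul_le_mul_left _ h1)
  · intro a ha
    obtain ⟨u₀, hu₀, rfl⟩ := Finset.mem_image.1 ha
    refine le_trans ?_ hcent
    refine Finset.card_le_card_of_injOn (fun u => h⁻¹ * u₀⁻¹ * u * h) (fun u hu => ?_) ?_
    · simp only [hs, Finset.coe_filter, Finset.mem_filter, Finset.mem_univ, true_and,
        Set.mem_ofPred_eq] at hu hu₀ ⊢
      refine ⟨by simp [hu.1.1, hu₀.1, hh], ?_⟩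
      have := enc_injective hu.2
      rw [hxy] at this
      have h3 : u * (h * y * h⁻¹) = u₀ * (h * y * h⁻¹) * u₀⁻¹ * u := by rw [← this]; group
      calc h⁻¹ * u₀⁻¹ * u * h * y = h⁻¹ * u₀⁻¹ * (u * (h * y * h⁻¹)) * h := by group
        _ = y * (h⁻¹ * u₀⁻¹ * u * h) := by rw [h3]; group
    · intro a _ b _ hab
      simpa using hab

theorem PrimeOrd.evenCard_inv3 {x : Equiv.Perm (Fin 6)} (hx : PrimeOrd x) (i : ℕ) :
    evenCard (fun u => inv3 (u * x * u⁻¹) = i) < 180 := by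
  obtain ⟨t, ht, -, h⟩ := hx.exists_table
  have h1 := h (fun y => inv3 y = i) (fun c => Nat.beq i (invc c))
    fun y hy => by rw [Nat.beq_eq, ← hy]; rfl
  refine lt_of_le_of_lt h1 ?_
  have h2 := List.all_eq_true.1 type_counts t ht
  rw [Bool.and_eq_true] at h2
  by_cases hi : i ∈ ((primes.filter fun c => Nat.beq (typc c) t.1).map invc)
  · have h3 := List.all_eq_true.1 h2.2 i (List.mem_dedup.2 hi)
    rw [Nat.ble_eq, cnt, List.countP_map] at h3
    rw [mul_comm]
    exact lt_of_le_of_lt h3 (by norm_num)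
  · rw [List.countP_eq_zero.2, mul_zero]
    · norm_num
    · intro c hc e
      rw [Nat.beq_eq] at e
      exact hi (List.mem_map.2 ⟨c, hc, e.symm⟩)

theorem PrimeOrd.evenCard_not_good {x : Equiv.Perm (Fin 6)} (hx : PrimeOrd x) :
    ∃ t ∈ typeTable, t.1 = typ x ∧ evenCard (fun u => ¬Good (u * x * u⁻¹)) ≤ t.2.2 := by
  obtain ⟨t, ht, htx, h⟩ := hx.exists_table
  refine ⟨t, ht, htx, le_trans (h (fun y => ¬Good y) (fun c => !goodc c)
    fun y hy => by simpa [Good] using hy) ?_⟩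
  have h2 := List.all_eq_true.1 type_counts t ht
  rw [Bool.and_eq_true, Nat.ble_eq] at h2
  rw [mul_comm]
  exact h2.1

/-- The six totals, each given by the codes of its five triple transpositions. -/
def totals : List (List ℕ) :=
  [[152769, 104994, 41259, 66396, 14421], [152769, 47146, 69987, 100948, 8989],
   [109313, 152090, 69987, 34028, 14421], [109313, 47146, 151635, 66396, 5349],
   [80193, 152090, 41259, 100948, 5349], [80193, 104994, 151635, 34028, 8989]]

def total (i : ℕ) : List ℕ := totals.getD i []

/-- `g` maps the total `i` to the total `j`. -/
def MapsTotal (g : Equiv.Perm (Fin 6)) (i j : Fin 6) : Prop :=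
  ∀ σ, enc σ ∈ total i.val → enc (g * σ * g⁻¹) ∈ total j.val

def mapsTotalsc (g p : ℕ) : Bool :=
  all6 fun i => (total i).all fun c => mem (conjc g c) (total (dig p i))

theorem mapsTotal_of_mapsTotalsc {g p : Equiv.Perm (Fin 6)}
    (h : mapsTotalsc (enc g) (enc p) = true) (i : Fin 6) : MapsTotal g i (p i) := by
  intro σ hσ
  have := List.all_eq_true.1 ((all6_iff _).1 h i) _ hσ
  rwa [mem_iff, conjc_enc, dig_enc] at this

theorem MapsTotal.unique {g : Equiv.Perm (Fin 6)} {i j j' : Fin 6} (h : MapsTotal g i j)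
    (h' : MapsTotal g i j') : j = j' := by
  by_contra hne
  have h2 : ∀ i : Fin 6, ∃ c d, c ∈ codes ∧ d ∈ codes ∧ c ∈ total i.val ∧ d ∈ total i.val ∧
      c ≠ d := by
    have : ∀ i : Fin 6, mem ((total i.val).getD 0 0) codes = true ∧
        mem ((total i.val).getD 1 0) codes = true ∧ (total i.val).getD 0 0 ∈ total i.val ∧
        (total i.val).getD 1 0 ∈ total i.val ∧
        (total i.val).getD 0 0 ≠ (total i.val).getD 1 0 := by decide +kernel
    exact fun i => ⟨_, _, mem_iff.1 (this i).1, mem_iff.1 (this i).2.1, (this i).2.2⟩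
  have hint : ∀ j j' : Fin 6, j ≠ j' → ∀ c ∈ total j.val, ∀ d ∈ total j.val,
      c ∈ total j'.val → d ∈ total j'.val → c = d := by decide +kernel
  obtain ⟨c, d, hc, hd, hci, hdi, hcd⟩ := h2 i
  obtain ⟨σ, rfl⟩ := exists_enc_eq hc
  obtain ⟨τ, rfl⟩ := exists_enc_eq hd
  have := hint j j' hne _ (h σ hci) _ (h τ hdi) (h' σ hci) (h' τ hdi)
  exact hcd (congrArg enc (by simpa using enc_injective this))

theorem MapsTotal.mul {g h : Equiv.Perm (Fin 6)} {i j l : Fin 6} (hg : MapsTotal g j l)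
    (hh : MapsTotal h i j) : MapsTotal (g * h) i l := by
  intro σ hσ
  have := hg _ (hh _ hσ)
  rwa [show g * h * σ * (g * h)⁻¹ = g * (h * σ * h⁻¹) * g⁻¹ by group]

theorem exists_mapsTotal (g : Equiv.Perm (Fin 6)) :
    ∃ p : Equiv.Perm (Fin 6), ∀ i, MapsTotal g i (p i) := by
  have hg : g ∈ Submonoid.closure (Set.range fun i : Fin 5 ↦ Equiv.swap i.castSucc i.succ) := by
    rw [mclosure_swap_castSucc_succ]; trivial
  induction hg using Submonoid.closure_induction with
  | mem g hg =>
    obtain ⟨i, rfl⟩ := hg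
    have h : ∀ i : Fin 5, ∃ p ∈ [152769, 104994, 80193, 152090, 109313],
        mem p codes = true ∧ mapsTotalsc (enc (Equiv.swap i.castSucc i.succ)) p = true := by
      decide +kernel
    obtain ⟨p, -, hp, h⟩ := h i
    obtain ⟨p, rfl⟩ := exists_enc_eq (mem_iff.1 hp)
    exact ⟨p, mapsTotal_of_mapsTotalsc h⟩
  | one => exact ⟨1, fun i σ hσ => by simpa using hσ⟩
  | mul g h _ _ hg hh =>
    obtain ⟨p, hp⟩ := hg
    obtain ⟨q, hq⟩ := hh
    exact ⟨p * q, fun i => (hp (q i)).mul (hq i)⟩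

/-- The action of the symmetric group on the six totals. -/
noncomputable def outHom : Equiv.Perm (Fin 6) →* Equiv.Perm (Fin 6) :=
  MonoidHom.mk' (fun g => (exists_mapsTotal g).choose) fun g h => Equiv.ext fun i =>
    ((exists_mapsTotal (g * h)).choose_spec i).unique
      (((exists_mapsTotal g).choose_spec _).mul ((exists_mapsTotal h).choose_spec i))

theorem outHom_eq {g p : Equiv.Perm (Fin 6)} (h : mapsTotalsc (enc g) (enc p) = true) :
    outHom g = p :=
  Equiv.ext fun i => ((exists_mapsTotal g).choose_spec i).unique (mapsTotal_of_mapsTotalsc h i)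

/-- Codes of some permutations and of their images under `outHom`. -/
def outTable : List (ℕ × ℕ) :=
  [(181889, 152769), (181441, 109320), (152769, 181889), (181777, 67691), (120849, 176268),
   (166097, 137026), (176401, 119820), (22737, 120912), (152776, 152776), (153168, 165460),
   (152216, 17053)]

theorem enc_outHom {c d : ℕ} (h : (c, d) ∈ outTable) {x : Equiv.Perm (Fin 6)} (hx : enc x = c) :
    enc (outHom x) = d := by
  have key : outTable.all (fun p => mem p.2 codes && mapsTotalsc p.1 p.2) = true := by
    decide +kernel
  have := List.all_eq_true.1 key _ h
  rw [Bool.and_eq_true, mem_iff] at this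
  obtain ⟨p, rfl⟩ := exists_enc_eq this.1
  rw [outHom_eq]
  rw [hx]
  exact this.2

theorem exists_pow_of_pow_eq_one {X : Type*} [Group X] {a : X} (ha : a ≠ 1) (h : a ^ 720 = 1) :
    ∃ n : ℕ, a ^ n ≠ 1 ∧ ((a ^ n) ^ 2 = 1 ∨ (a ^ n) ^ 3 = 1 ∨ (a ^ n) ^ 5 = 1) := by
  have hm : orderOf a ≠ 1 := fun h1 => ha (orderOf_eq_one_iff.1 h1)
  have hd : orderOf a ∣ 720 := orderOf_dvd_of_pow_eq_one h
  have hp := Nat.minFac_prime hm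
  set p := (orderOf a).minFac with hpdef
  obtain ⟨n, hn⟩ := Nat.minFac_dvd (orderOf a)
  rw [← hpdef] at hn
  have hn0 : 0 < n := by
    rcases Nat.eq_zero_or_pos n with h0 | h0
    · rw [h0, mul_zero] at hn; rw [hn] at hd; omega
    · exact h0
  refine ⟨n, fun h1 => ?_, ?_⟩
  · have h2 := Nat.le_of_dvd hn0 (orderOf_dvd_of_pow_eq_one h1)
    have := hp.two_le
    nlinarith
  · have hap : (a ^ n) ^ p = 1 := by rw [← pow_mul, mul_comm, ← hn, pow_orderOf_eq_one]
    have h720 : p ∣ 2 ^ 4 * 3 ^ 2 * 5 := (Dvd.intro n hn.symm).trans hd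
    rcases (Nat.Prime.dvd_mul hp).1 h720 with h1 | h1
    · rcases (Nat.Prime.dvd_mul hp).1 h1 with h1 | h1
      · rw [(Nat.prime_dvd_prime_iff_eq hp Nat.prime_two).1 (hp.dvd_of_dvd_pow h1)] at hap
        exact Or.inl hap
      · rw [(Nat.prime_dvd_prime_iff_eq hp Nat.prime_three).1 (hp.dvd_of_dvd_pow h1)] at hap
        exact Or.inr (Or.inl hap)
    · rw [(Nat.prime_dvd_prime_iff_eq hp Nat.prime_five).1 h1] at hap
      exact Or.inr (Or.inr hap)

theorem perm_pow (x : Equiv.Perm (Fin 6)) : x ^ 720 = 1 := by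
  have := pow_card_eq_one (x := x)
  rwa [Fintype.card_perm] at this

theorem outHom_injective : Function.Injective outHom := by
  rw [injective_iff_map_eq_one]
  intro x hx
  by_contra hne
  obtain ⟨n, h1, h2⟩ := exists_pow_of_pow_eq_one hne (perm_pow x)
  obtain ⟨g, y, -, hy, -, hxy⟩ := PrimeOrd.exists_rep ⟨h1, h2⟩
  have h3 : outHom (g * y * g⁻¹) = 1 := by rw [← hxy, map_pow, hx, one_pow]
  rw [map_mul, map_mul, map_inv, conj_eq_one_iff] at h3
  have h4 : ∀ r ∈ reps, ∃ p ∈ outTable, p.1 = r ∧ p.2 ≠ idc := by decide +kernel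
  obtain ⟨p, hp, hr, hne⟩ := h4 _ hy
  apply hne
  rw [← enc_outHom hp hr.symm, h3, enc_one]

/-- An outer automorphism of the symmetric group of degree six. -/
noncomputable def out : Equiv.Perm (Fin 6) ≃* Equiv.Perm (Fin 6) :=
  MulEquiv.ofBijective outHom (Finite.injective_iff_bijective.1 outHom_injective)

theorem enc_out {c d : ℕ} (h : (c, d) ∈ outTable) {x : Equiv.Perm (Fin 6)} (hx : enc x = c) :
    enc (out x) = d := enc_outHom h hx

theorem sign_out (x : Equiv.Perm (Fin 6)) : sign (out x) = sign x := by
  have h01 : sign (out (Equiv.swap 0 1)) = -1 := by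
    rw [sign_eq, enc_out (c := 181889) (d := 152769) (by decide +kernel) (by decide +kernel)]
    decide +kernel
  induction x using swap_induction_on with
  | one => simp
  | swap_mul f i j hij ih =>
    obtain ⟨g, hg⟩ := isConj_iff.1 (isConj_swap (show (0 : Fin 6) ≠ 1 by decide) hij)
    rw [← hg]
    simp only [map_mul, map_inv, ih, h01, sign_swap (show (0 : Fin 6) ≠ 1 by decide)]
    rw [mul_right_comm (sign (out g)), mul_right_comm (sign g), mul_inv_cancel, mul_inv_cancel]

theorem PrimeOrd.out {x : Equiv.Perm (Fin 6)} (hx : PrimeOrd x) : PrimeOrd (out x) := by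
  refine ⟨fun h => hx.1 ((map_eq_one_iff _ S6.out.injective).1 h), ?_⟩
  simp only [← map_pow, map_eq_one_iff _ S6.out.injective]
  exact hx.2

/-- The action of `out` on types. -/
def typeMap : List (ℕ × ℕ) := [(34, 2), (18, 18), (2, 34), (27, 3), (3, 27), (13, 13)]

theorem PrimeOrd.typ_out {x : Equiv.Perm (Fin 6)} (hx : PrimeOrd x) :
    (typ x, typ (S6.out x)) ∈ typeMap := by
  obtain ⟨g, y, -, hy, ht, rfl⟩ := hx.exists_rep
  have h4 : ∀ r ∈ reps, ∃ p ∈ outTable, p.1 = r ∧ (typc p.1, typc p.2) ∈ typeMap := by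
    decide +kernel
  obtain ⟨p, hp, hr, h⟩ := h4 _ hy
  rw [map_mul, map_mul, map_inv, typ_conj, typ_conj]
  rwa [hr, ← enc_out hp hr.symm] at h

/-! ### Common conjugators -/

/-- Some even permutation conjugates both `x` and `y` to mates of `v`. -/
def Compat (x y : Equiv.Perm (Fin 6)) : Prop :=
  ∃ u, sign u = 1 ∧ Good (u * x * u⁻¹) ∧ Good (u * y * u⁻¹)

theorem Compat.symm {x y : Equiv.Perm (Fin 6)} (h : Compat x y) : Compat y x := by
  obtain ⟨u, hu, h1, h2⟩ := h
  exact ⟨u, hu, h2, h1⟩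

theorem PrimeOrd.exists_good {x : Equiv.Perm (Fin 6)} (hx : PrimeOrd x) (h : typ x ≠ 34) :
    ∃ u, sign u = 1 ∧ Good (u * x * u⁻¹) := by
  obtain ⟨t, ht, htx, hb⟩ := hx.evenCard_not_good
  have h252 : ∀ t ∈ typeTable, t.1 ≠ 34 → t.2.2 ≤ 252 := by decide
  have h1 := h252 t ht (htx ▸ h)
  obtain ⟨u, hu, h2, -⟩ := exists_even_avoiding (P := fun u => ¬Good (u * x * u⁻¹))
    (Q := fun _ => False) (by
      have : evenCard (fun _ => False) = 0 := by simp [evenCard]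
      omega)
  exact ⟨u, hu, not_not.1 h2⟩

/-- The pairs of types for which counting does not suffice. -/
def directPairs : List (ℕ × ℕ) := [(18, 18), (18, 2), (2, 2), (27, 2)]

theorem compat_of_direct {x y : Equiv.Perm (Fin 6)} (hx : PrimeOrd x) (hy : PrimeOrd y)
    (h : (typ x, typ y) ∈ directPairs) : Compat x y := by
  obtain ⟨g, z, hg, hz, ht, rfl⟩ := hx.exists_rep
  rw [typ_conj] at h
  have h4 : ∀ r ∈ reps, ∀ p ∈ directPairs, typc r = p.1 →
      (r, p.2) ∈ ([(181441, 18), (181441, 2), (152769, 2), (181777, 2)] : List (ℕ × ℕ)) := by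
    decide +kernel
  have hm := h4 _ hz _ h rfl
  have hy' := hy.conj g⁻¹
  have h5 := List.all_eq_true.1 (List.all_eq_true.1 good_pairs _ hm) _ hy'.mem
  have h6 : typc (enc (g⁻¹ * y * g⁻¹⁻¹)) = typ y := typ_conj _ _
  simp only [h6, Nat.beq_refl, Bool.not_true, Bool.false_or] at h5
  obtain ⟨c, hc, h5⟩ := List.any_eq_true.1 h5
  obtain ⟨u, hu, rfl⟩ := exists_even hc
  rw [Bool.and_eq_true, conjc_enc, conjc_enc] at h5
  refine ⟨u * g⁻¹, by simp [hu, hg], ?_, ?_⟩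
  · rw [show u * g⁻¹ * (g * z * g⁻¹) * (u * g⁻¹)⁻¹ = u * z * u⁻¹ by group]
    exact h5.1
  · rw [show u * g⁻¹ * y * (u * g⁻¹)⁻¹ = u * (g⁻¹ * y * g⁻¹⁻¹) * u⁻¹ by group]
    exact h5.2

theorem compat_cases {x y : Equiv.Perm (Fin 6)} (hx : PrimeOrd x) (hy : PrimeOrd y) :
    Compat x y ∨ Compat (out x) (out y) ∨ (typ x = 34 ∧ typ y = 2) ∨ (typ x = 2 ∧ typ y = 34) := by
  have main : ∀ x y, PrimeOrd x → PrimeOrd y → ∃ s ∈ typeTable, ∃ t ∈ typeTable,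
      s.1 = typ x ∧ t.1 = typ y ∧ ((s.2.2 + t.2.2 < 360 ∨ (s.1, t.1) ∈ directPairs ∨
        (t.1, s.1) ∈ directPairs) → Compat x y) := by
    intro x y hx hy
    obtain ⟨s, hs, hsx, hsb⟩ := hx.evenCard_not_good
    obtain ⟨t, ht, hty, htb⟩ := hy.evenCard_not_good
    refine ⟨s, hs, t, ht, hsx, hty, ?_⟩
    rintro (h | h | h)
    · obtain ⟨u, hu, h1, h2⟩ := exists_even_avoiding (lt_of_le_of_lt (add_le_add hsb htb) h)
      exact ⟨u, hu, not_not.1 h1, not_not.1 h2⟩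
    · exact compat_of_direct hx hy (by rwa [← hsx, ← hty])
    · exact (compat_of_direct hy hx (by rwa [← hsx, ← hty])).symm
  obtain ⟨s, hs, t, ht, hsx, hty, h1⟩ := main x y hx hy
  obtain ⟨s', hs', t', ht', hsx', hty', h2⟩ := main _ _ hx.out hy.out
  have hm := hx.typ_out
  have hm' := hy.typ_out
  rw [← hsx, ← hsx'] at hm
  rw [← hty, ← hty'] at hm'
  have key : ∀ s ∈ typeTable, ∀ t ∈ typeTable, ∀ s' ∈ typeTable, (s.1, s'.1) ∈ typeMap →
      ∀ t' ∈ typeTable, (t.1, t'.1) ∈ typeMap →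
      (s.2.2 + t.2.2 < 360 ∨ (s.1, t.1) ∈ directPairs ∨ (t.1, s.1) ∈ directPairs) ∨
      (s'.2.2 + t'.2.2 < 360 ∨ (s'.1, t'.1) ∈ directPairs ∨ (t'.1, s'.1) ∈ directPairs) ∨
      (s.1 = 34 ∧ t.1 = 2) ∨ (s.1 = 2 ∧ t.1 = 34) := by decide +kernel
  rcases key s hs t ht s' hs' hm t' ht' hm' with h | h | h
  · exact Or.inl (h1 h)
  · exact Or.inr (Or.inl (h2 h))
  · rw [hsx, hty] at h
    exact Or.inr (Or.inr h)

/-! ### Separation of transpositions -/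

theorem fx_eq_four_of_typ {x : Equiv.Perm (Fin 6)} (ht : typ x = 34) : fx x = 4 := by
  have h : fx x * 8 + ordc (enc x) = 34 := ht
  have h1 : ordc (enc x) ≤ 6 ∧ 1 ≤ ordc (enc x) := by
    rw [ordc_cases]; split_ifs <;> omega
  omega

theorem inv3_ne_of_swap {x ρ : Equiv.Perm (Fin 6)} (hx : PrimeOrd x) (ht : typ x = 34)
    (hρ : PrimeOrd ρ) (hg : Good ρ) : inv3 x ≠ inv3 ρ := by
  intro h
  have h1 := List.all_eq_true.1 good_inv_ne_swap _ hρ.mem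
  have h2 : mem (invc (enc ρ)) ((primes.filter fun d => Nat.beq (fixc d) 4).map invc) = true :=
    mem_iff.2 (List.mem_map.2 ⟨enc x, List.mem_filter.2 ⟨hx.mem,
      (Nat.beq_eq ▸ fx_eq_four_of_typ ht :)⟩, h⟩)
  rw [h2, Bool.true_and, show goodc (enc ρ) = true from hg] at h1
  exact absurd h1 (by decide)

theorem ordc_one_iff (σ : Equiv.Perm (Fin 6)) : ordc (enc σ) = 1 ↔ σ = 1 := by
  rw [ordc_cases]; split_ifs <;> simp_all

theorem inv3_one_ne {ρ : Equiv.Perm (Fin 6)} (hρ : ρ ≠ 1) : inv3 1 ≠ inv3 ρ := by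
  have h1 : inv3 1 = 115 := by
    rw [inv3, enc_one]; decide +kernel
  have h2 : 2 ≤ ordc (enc ρ) := by
    have := mt (ordc_one_iff ρ).1 hρ
    have : 1 ≤ ordc (enc ρ) := by rw [ordc_cases]; split_ifs <;> omega
    omega
  rw [h1, inv3, invc]
  omega

theorem Good.ne_one {σ : Equiv.Perm (Fin 6)} (h : Good σ) : σ ≠ 1 := by
  rintro rfl
  have : goodc idc = false := by decide +kernel
  rw [Good, enc_one, this] at h
  exact absurd h (by decide)

/-! ### A transposition together with a product of three transpositions -/

theorem exists_conj_swap {x : Equiv.Perm (Fin 6)} (hx : PrimeOrd x) (ht : typ x = 34) :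
    ∃ g, sign g = 1 ∧ enc (g * x * g⁻¹) = 181889 := by
  obtain ⟨g, y, hg, hy, hty, rfl⟩ := hx.exists_rep
  have h : ∀ r ∈ reps, typc r = 34 → r = 181889 := by decide +kernel
  refine ⟨g⁻¹, by simp [hg], ?_⟩
  rw [show g⁻¹ * (g * y * g⁻¹) * g⁻¹⁻¹ = y by group]
  exact h _ hy (hty.trans ht)

/-- For a product `x` of three transpositions and a transposition `x'`, conjugators for two
coordinates. -/
theorem exists_two_conj : ∃ i₀ d₀ d₁, inv3 d₀ ≠ inv3 d₁ ∧ closure {v, d₀, d₁} = ⊤ ∧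
    ∀ x x', PrimeOrd x → PrimeOrd x' → typ x = 2 → typ x' = 34 →
      (∃ g, sign g = 1 ∧ g * x' * g⁻¹ = d₀ ∧ Good (g * x * g⁻¹) ∧ inv3 (g * x * g⁻¹) = i₀) ∧
      ∃ g, sign g = 1 ∧ g * x' * g⁻¹ = d₁ ∧ inv3 (g * x * g⁻¹) ≠ i₀ := by
  have hmem : mem 117384 codes = true ∧ mem 180363 codes = true := by decide +kernel
  obtain ⟨d₀, hd₀⟩ := exists_enc_eq (mem_iff.1 hmem.1)
  obtain ⟨d₁, hd₁⟩ := exists_enc_eq (mem_iff.1 hmem.2)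
  have hs := swap_swap
  rw [Bool.and_eq_true, Bool.not_eq_true', Nat.beq_eq] at hs
  refine ⟨174, d₀, d₁, ?_, ?_, fun x x' hx hx' ht ht' => ?_⟩
  · rw [inv3, inv3, hd₀, hd₁]
    exact Nat.ne_of_beq_eq_false hs.2
  · have hv : v ∈ closure {v, d₀, d₁} := subset_closure (by simp)
    have h₀ : d₀ ∈ closure {v, d₀, d₁} := subset_closure (by simp)
    have h₁ : d₁ ∈ closure {v, d₀, d₁} := subset_closure (by simp)
    have := (linked_v hv).spread [d₀, d₁, v, d₀, d₁, v, d₀, d₁] (by simp [hv, h₀, h₁])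
    simp only [List.map_cons, List.map_nil, hd₀, hd₁, enc_v, hs.1] at this
    exact this.eq_top
  · obtain ⟨g, hg, hgx⟩ := exists_conj_swap hx' ht'
    have h := List.all_eq_true.1 swap_triple _ (hx.conj g).mem
    rw [show typc (enc (g * x * g⁻¹)) = 2 from (typ_conj _ _).trans ht] at h
    simp only [Nat.beq_refl, Bool.not_true, Bool.false_or, Bool.and_eq_true, List.any_eq_true,
      Nat.beq_eq, Bool.not_eq_true'] at h
    obtain ⟨⟨c, hc, ⟨h1, h2⟩, h3⟩, c', hc', h4, h5⟩ := h
    obtain ⟨u, hu, rfl⟩ := exists_even hc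
    obtain ⟨u', hu', rfl⟩ := exists_even hc'
    have e : ∀ u y, u * (g * y * g⁻¹) * u⁻¹ = (u * g) * y * (u * g)⁻¹ := fun u y => by group
    rw [← hgx, conjc_enc, ← hd₀, e] at h1
    rw [← hgx, conjc_enc, ← hd₁, e] at h4
    rw [conjc_enc, e] at h2 h3 h5
    exact ⟨⟨u * g, by simp [hu, hg], enc_injective h1, h2, h3⟩,
      u' * g, by simp [hu', hg], enc_injective h4, Nat.ne_of_beq_eq_false h5⟩

theorem isSwap_of_fx {z : Equiv.Perm (Fin 6)} (h : fx z = 4) : z.IsSwap := by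
  rw [← card_support_eq_two]
  have h1 := Finset.card_filter_add_card_filter_not (s := (Finset.univ : Finset (Fin 6)))
    (fun i => z i = i)
  rw [← fx_eq_card, h, Finset.card_univ, Fintype.card_fin] at h1
  have h2 : z.support = Finset.univ.filter fun i => ¬z i = i := by ext; simp
  rw [h2]
  omega

theorem exists_common_mate {x x' : Equiv.Perm (Fin 6)} (hx : PrimeOrd x) (hx' : PrimeOrd x')
    (ht : typ x = 2) (ht' : typ x' = 34) : ∃ w, closure {x, w} = ⊤ ∧ closure {x', w} = ⊤ := by
  obtain ⟨g, hg, hgx⟩ := exists_conj_swap hx' ht'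
  have h := List.all_eq_true.1 swap_triple_five _ (hx.conj g).mem
  rw [show typc (enc (g * x * g⁻¹)) = 2 from (typ_conj _ _).trans ht] at h
  simp only [Nat.beq_refl, Bool.not_true, Bool.false_or, Bool.and_eq_true, List.any_eq_true,
    Nat.beq_eq] at h
  obtain ⟨c, hc, ⟨h1, h2⟩, h3⟩ := h
  obtain ⟨w, -, rfl⟩ := exists_even hc
  set y := g * x * g⁻¹ with hy
  set y' := g * x' * g⁻¹ with hy'
  simp only [mulc_enc] at h1 h2 h3
  have hswap : y' = Equiv.swap 0 1 := enc_injective (hgx.trans (by decide +kernel))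
  have key : ∀ z, closure {g * z * g⁻¹, w} = ⊤ → closure {z, g⁻¹ * w * g} = ⊤ := by
    intro z hz
    have h := congrArg (Subgroup.map (MulAut.conj g⁻¹).toMonoidHom) hz
    rw [MonoidHom.map_closure, Set.image_pair] at h
    simp only [MulEquiv.coe_toMonoidHom, MulAut.conj_apply, inv_inv] at h
    rw [show g⁻¹ * (g * z * g⁻¹) * g = z by group] at h
    rw [h]
    exact Subgroup.map_top_of_surjective _ (MulAut.conj g⁻¹).surjective
  refine ⟨g⁻¹ * w * g, key x ?_, key x' ?_⟩
  · rw [← hy]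
    have hym : y ∈ closure {y, w} := subset_closure (by simp)
    have hwm : w ∈ closure {y, w} := subset_closure (by simp)
    set z := y * w * (y * w * (y * w)) with hz
    have hzm : z ∈ closure {y, w} := by
      have h := mul_mem hym hwm
      exact mul_mem h (mul_mem h h)
    obtain ⟨i, j, hij, hzs⟩ := isSwap_of_fx h1
    rw [hzs] at hzm
    have hl : Linked (closure {y, w}) (movedc (enc z)) := by
      apply linked_swap hzm
      intro l hl
      rw [movedc, tb_mask, dig_enc, Bool.not_eq_true'] at hl
      by_contra hne
      push Not at hne
      rw [hzs, Equiv.swap_apply_of_ne_of_ne hne.1 hne.2, Nat.beq_refl] at hl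
      exact absurd hl (by decide)
    have := hl.spread [w, w * w, y, w, w * w, y] (by simp [hym, hwm, mul_mem])
    simp only [List.map_cons, List.map_nil, h2] at this
    exact this.eq_top
  · rw [← hy']
    have hym : y' ∈ closure {y', w} := subset_closure (by simp)
    have hwm : w ∈ closure {y', w} := subset_closure (by simp)
    have hl : Linked (closure {y', w}) 3 := linked_swap (i := 0) (j := 1)
      (by rw [← hswap]; exact hym) (by decide)
    have := hl.spread [w, w * w, w, w * w] (by simp [hwm, mul_mem])
    simp only [List.map_cons, List.map_nil, h3] at this
    exact this.eq_top

/-! ### Six-cycles and non-generation -/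

/-- Six-cycles, characterized among odd permutations. -/
def Six (w : Equiv.Perm (Fin 6)) : Prop := isSix (enc w) = true

theorem six_iff (w : Equiv.Perm (Fin 6)) : Six w ↔ sign w = -1 ∧ fx w = 0 ∧ w ^ 2 ≠ 1 := by
  have h1 : invParity (enc w) = 1 ↔ sign w = -1 := by
    rw [sign_eq]
    have : invParity (enc w) < 2 := Nat.mod_lt _ (by decide)
    split_ifs with h
    · rw [h]; decide
    · simp; omega
  simp only [Six, isSix, Bool.and_eq_true, mulc_enc, Bool.not_eq_true', ← Bool.not_eq_true,
    beq_idc]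
  simp only [Nat.beq_eq, h1, pow_two, fx, and_assoc]

theorem six_conj (g w : Equiv.Perm (Fin 6)) : Six (g * w * g⁻¹) ↔ Six w := by
  rw [six_iff, six_iff, fx_conj, Ne, conj_pow_eq_one]
  simp [mul_right_comm (sign g)]

theorem Six.not_out {w : Equiv.Perm (Fin 6)} (h : Six w) : ¬Six (out w) := by
  have h0 := List.all_eq_true.1 six_orbit _ (enc_mem_codes w)
  rw [show isSix (enc w) = true from h, Bool.not_true, Bool.false_or] at h0
  obtain ⟨g, y, -, hy, rfl⟩ := exists_of_mem_orbit (mem_iff.1 (by decide +kernel)) h0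
  rw [map_mul, map_mul, map_inv, six_conj, Six, enc_out (d := 120912) (by decide +kernel) hy]
  decide +kernel

/-- The tuples of codes of elements for which no odd permutation other than a six-cycle is a
common mate. -/
def obstructions : List (List ℕ) :=
  [[181889], [181777, 120968], [152776, 153168, 152216], [152776, 165460, 17053]]

theorem exists_closure_ne_top {l : List ℕ} (hl : l ∈ obstructions) {w : Equiv.Perm (Fin 6)}
    (hw : sign w = -1) (h6 : ¬Six w) : ∃ c ∈ l, ∀ x, enc x = c → closure {x, w} ≠ ⊤ := by
  have h := List.all_eq_true.1 bad_odds _ (enc_mem_codes w)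
  have hp : Nat.beq (invParity (enc w)) 0 = false := by
    rw [sign_eq] at hw
    split_ifs at hw with h
    · exact absurd hw (by decide)
    · rwa [← Bool.not_eq_true, Nat.beq_eq]
  have hb : ∀ c, badc c (enc w) = true → ∀ x, enc x = c → closure {x, w} ≠ ⊤ := by
    rintro c hc x rfl
    exact closure_ne_top_of_badc hc
  rw [hp, show isSix (enc w) = false by simpa [Six] using h6] at h
  simp only [Bool.false_or, Bool.and_eq_true, Bool.or_eq_true, or_assoc] at h
  obtain ⟨⟨⟨h1, h2⟩, h3⟩, h4⟩ := h
  simp only [obstructions, List.mem_cons, List.not_mem_nil, or_false] at hl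
  rcases hl with rfl | rfl | rfl | rfl
  · exact ⟨_, by simp, hb _ h1⟩
  · rcases h2 with h | h <;> exact ⟨_, by simp, hb _ h⟩
  · rcases h3 with h | h | h <;> exact ⟨_, by simp, hb _ h⟩
  · rcases h4 with h | h | h <;> exact ⟨_, by simp, hb _ h⟩

theorem closure_out {x w : Equiv.Perm (Fin 6)} (h : closure {x, w} = ⊤) :
    closure {out x, out w} = ⊤ := by
  have h := congrArg (Subgroup.map out.toMonoidHom) h
  rw [MonoidHom.map_closure, Set.image_pair] at h
  exact h.trans (Subgroup.map_top_of_surjective _ out.surjective)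

/-! ### Subgroups containing the alternating group -/

theorem mem_of_sign_eq_one {K : Subgroup (Equiv.Perm (Fin 6))}
    (hK : ∀ g, sign g = 1 → ∀ z ∈ K, g * z * g⁻¹ ∈ K) {z : Equiv.Perm (Fin 6)} (hz : z ∈ K)
    (hs : sign z = 1) (h1 : z ≠ 1) {x : Equiv.Perm (Fin 6)} (hx : sign x = 1) : x ∈ K := by
  have : IsSimpleGroup (alternatingGroup (Fin 6)) := alternatingGroup.isSimpleGroup (by simp)
  let L := K.subgroupOf (alternatingGroup (Fin 6))
  have hn : L.Normal := ⟨fun n hn g => by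
    rw [mem_subgroupOf] at hn ⊢
    exact hK _ (mem_alternatingGroup.1 g.2) _ hn⟩
  rcases hn.eq_bot_or_eq_top with h | h
  · have : (⟨z, mem_alternatingGroup.2 hs⟩ : alternatingGroup (Fin 6)) ∈ L := hz
    rw [h, mem_bot] at this
    exact absurd (congrArg Subtype.val this) h1
  · have : (⟨x, mem_alternatingGroup.2 hx⟩ : alternatingGroup (Fin 6)) ∈ L := h ▸ mem_top _
    exact this

theorem exists_not_commute {x : Equiv.Perm (Fin 6)} (hx : x ≠ 1) :
    ∃ d, sign d = 1 ∧ x * d ≠ d * x := by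
  obtain ⟨i, hi⟩ : ∃ i, x i ≠ i := by
    by_contra! h
    exact hx (Equiv.ext h)
  obtain ⟨j, l, h⟩ : ∃ j l : Fin 6, i ≠ j ∧ i ≠ l ∧ j ≠ l ∧ x i ≠ j ∧ x i ≠ l := by
    have : ∀ i m : Fin 6, ∃ j l : Fin 6, i ≠ j ∧ i ≠ l ∧ j ≠ l ∧ m ≠ j ∧ m ≠ l := by decide
    exact this i (x i)
  refine ⟨Equiv.swap i j * Equiv.swap j l, by
    rw [map_mul, sign_swap h.1, sign_swap h.2.2.1]; rfl, fun e => ?_⟩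
  have := DFunLike.congr_fun e i
  simp only [mul_apply] at this
  rw [Equiv.swap_apply_of_ne_of_ne h.1 h.2.1, Equiv.swap_apply_left,
    Equiv.swap_apply_of_ne_of_ne h.2.2.2.1 h.2.2.2.2,
    Equiv.swap_apply_of_ne_of_ne hi h.2.2.2.1] at this
  exact h.1 (x.injective this).symm

theorem exists_conj_not_commute {x y : Equiv.Perm (Fin 6)} (hx : x ≠ 1) (hy : y ≠ 1)
    (hs : sign y = 1) : ∃ h, sign h = 1 ∧ x * (h * y * h⁻¹) ≠ (h * y * h⁻¹) * x := by
  by_contra! hc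
  obtain ⟨d, hd, hne⟩ := exists_not_commute hx
  let K : Subgroup (Equiv.Perm (Fin 6)) :=
    { carrier := {z | ∀ h, sign h = 1 → Commute x (h * z * h⁻¹)}
      one_mem' := fun h _ => by simp
      mul_mem' := fun {a b} ha hb h hh => by
        have := (ha h hh).mul_right (hb h hh)
        rwa [show h * a * h⁻¹ * (h * b * h⁻¹) = h * (a * b) * h⁻¹ by group] at this
      inv_mem' := fun {a} ha h hh => by
        have := (ha h hh).inv_right
        rwa [show (h * a * h⁻¹)⁻¹ = h * a⁻¹ * h⁻¹ by group] at this }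
  have hK : ∀ g, sign g = 1 → ∀ z ∈ K, g * z * g⁻¹ ∈ K := by
    intro g hg z hz h hh
    have := hz (h * g) (by simp [hg, hh])
    rwa [show h * g * z * (h * g)⁻¹ = h * (g * z * g⁻¹) * h⁻¹ by group] at this
  have hdK : d ∈ K := mem_of_sign_eq_one (z := y) hK (fun h hh => hc h hh) hs hy hd
  have := hdK 1 (by simp)
  simp only [one_mul, inv_one, mul_one] at this
  exact hne this

theorem eq_top_of_sign {Q : Subgroup (Equiv.Perm (Fin 6))} (hQ : ∀ x, sign x = 1 → x ∈ Q)
    {s : Equiv.Perm (Fin 6)} (hs : sign s = -1) (hsQ : s ∈ Q) : Q = ⊤ := by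
  rw [eq_top_iff]
  intro x _
  rcases Int.units_eq_one_or (sign x) with h | h
  · exact hQ x h
  · have := Q.mul_mem (hQ (x * s⁻¹) (by simp [h, hs])) hsQ
    rwa [inv_mul_cancel_right] at this

theorem nsmul_one_val {k : ℕ} [NeZero k] (j : ℕ) : (j • (1 : Fin k)).val = j % k := by
  induction j with
  | zero => simp
  | succ n ih => rw [succ_nsmul, Fin.val_add, ih, Fin.val_one', ← Nat.add_mod]

theorem val_nsmul_one {k : ℕ} [NeZero k] (q : Fin k) : q.val • (1 : Fin k) = q :=
  Fin.ext (by rw [nsmul_one_val, Nat.mod_eq_of_lt q.2])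

theorem card_nsmul_fin {k : ℕ} [NeZero k] (q : Fin k) : k • q = 0 := by
  simpa using card_nsmul_eq_zero' (x := q)

/-! ### The wreath product with a cyclic group -/

/-- The wreath product of the symmetric group of degree six with a cyclic group of order `k`. -/
@[ext] structure Wr (k : ℕ) where
  base : Fin k → Equiv.Perm (Fin 6)
  rot : Fin k

namespace Wr

variable {k : ℕ}

instance : Mul (Wr k) := ⟨fun a b => ⟨fun i => a.base i * b.base (i - a.rot), a.rot + b.rot⟩⟩
instance : Inv (Wr k) := ⟨fun a => ⟨fun i => (a.base (i + a.rot))⁻¹, -a.rot⟩⟩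

theorem mul_base (a b : Wr k) (i : Fin k) : (a * b).base i = a.base i * b.base (i - a.rot) := rfl
theorem mul_rot (a b : Wr k) : (a * b).rot = a.rot + b.rot := rfl
theorem inv_base (a : Wr k) (i : Fin k) : a⁻¹.base i = (a.base (i + a.rot))⁻¹ := rfl
theorem inv_rot (a : Wr k) : a⁻¹.rot = -a.rot := rfl

variable [NeZero k]

instance : One (Wr k) := ⟨⟨1, 0⟩⟩

theorem one_base (i : Fin k) : (1 : Wr k).base i = 1 := rfl
theorem one_rot : (1 : Wr k).rot = 0 := rfl

instance : Group (Wr k) := Group.ofLeftAxioms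
  (fun a b c => Wr.ext (by
    funext i
    simp only [mul_base, mul_rot, mul_assoc, sub_sub]) (by simp only [mul_rot, add_assoc]))
  (fun a => Wr.ext (by
    funext i
    simp only [mul_base, one_base, one_rot, one_mul, sub_zero])
    (by simp only [mul_rot, one_rot, zero_add]))
  (fun a => Wr.ext (by
    funext i
    simp only [mul_base, inv_base, inv_rot, one_base, sub_neg_eq_add, inv_mul_cancel])
    (by simp only [mul_rot, inv_rot, one_rot, neg_add_cancel]))

/-- The rotation part as a homomorphism. -/
def rotHom : Wr k →* Multiplicative (Fin k) where
  toFun a := Multiplicative.ofAdd a.rot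
  map_one' := rfl
  map_mul' _ _ := rfl

theorem pow_rot (a : Wr k) (n : ℕ) : (a ^ n).rot = n • a.rot := map_pow rotHom a n
theorem zpow_rot (a : Wr k) (n : ℤ) : (a ^ n).rot = n • a.rot := map_zpow rotHom a n

/-- The base group. -/
def ofBase : (Fin k → Equiv.Perm (Fin 6)) →* Wr k where
  toFun α := ⟨α, 0⟩
  map_one' := rfl
  map_mul' α β := Wr.ext (by funext i; simp [mul_base]) (by simp [mul_rot])

theorem ofBase_base (α : Fin k → Equiv.Perm (Fin 6)) : (ofBase α).base = α := rfl
theorem ofBase_rot (α : Fin k → Equiv.Perm (Fin 6)) : (ofBase α).rot = 0 := rfl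
theorem eq_ofBase {a : Wr k} (h : a.rot = 0) : a = ofBase a.base := Wr.ext rfl h

theorem conj_ofBase (a : Wr k) (α : Fin k → Equiv.Perm (Fin 6)) :
    a * ofBase α * a⁻¹ = ofBase fun i => a.base i * α (i - a.rot) * (a.base i)⁻¹ :=
  Wr.ext (by
    funext i
    simp only [mul_base, inv_base, ofBase_base, mul_rot, ofBase_rot, add_zero, sub_add_cancel])
    (by simp [mul_rot, inv_rot, ofBase_rot])

theorem ofBase_conj (γ : Fin k → Equiv.Perm (Fin 6)) (a : Wr k) :
    ofBase γ * a * (ofBase γ)⁻¹ = ⟨fun i => γ i * a.base i * (γ (i - a.rot))⁻¹, a.rot⟩ :=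
  Wr.ext (by
    funext i
    simp only [mul_base, inv_base, ofBase_base, mul_rot, ofBase_rot, add_zero, sub_zero, zero_add])
    (by simp [mul_rot, inv_rot, ofBase_rot])

/-- The generator of the top group, twisted by `s` at one coordinate. -/
def shift (s : Equiv.Perm (Fin 6)) : Wr k := ⟨Pi.mulSingle 0 s, 1⟩

theorem shift_base_zero (s : Equiv.Perm (Fin 6)) : (shift s : Wr k).base 0 = s :=
  Pi.mulSingle_eq_same (M := fun _ : Fin k => Equiv.Perm (Fin 6)) 0 s

theorem shift_base_of_ne (s : Equiv.Perm (Fin 6)) {i : Fin k} (hi : i ≠ 0) :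
    (shift s : Wr k).base i = 1 := Pi.mulSingle_eq_of_ne hi _

theorem shift_rot (s : Equiv.Perm (Fin 6)) : (shift s : Wr k).rot = 1 := rfl

theorem shift_pow_base (s : Equiv.Perm (Fin 6)) (j : ℕ) (hj : j ≤ k) (i : Fin k) :
    ((shift s : Wr k) ^ j).base i = if i.val < j then s else 1 := by
  induction j generalizing i with
  | zero => simp [one_base]
  | succ n ih =>
    rw [pow_succ', mul_base, shift_rot, ih (by omega)]
    by_cases hi : i = 0
    · subst hi
      have h1 : ((0 : Fin k) - 1).val = k - 1 := by
        rw [Fin.val_sub]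
        rcases Nat.lt_or_ge 1 k with h | h
        · simp [Nat.mod_eq_of_lt h, Nat.mod_eq_of_lt (show k - 1 < k by omega)]
        · have : k = 1 := by omega
          subst this; exact Nat.mod_one _
      rw [shift_base_zero, h1, if_neg (by omega), mul_one]
      simp
    · rw [shift_base_of_ne s hi, one_mul, Fin.val_sub_one_of_ne_zero hi]
      have : i.val ≠ 0 := fun h => hi (Fin.ext h)
      congr 1
      simp only [eq_iff_iff]
      omega

theorem shift_pow (s : Equiv.Perm (Fin 6)) : (shift s : Wr k) ^ k = ofBase fun _ => s :=
  Wr.ext (by funext i; rw [shift_pow_base s k le_rfl, if_pos i.2, ofBase_base])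
    (by rw [pow_rot, ofBase_rot, card_nsmul_fin])

theorem exists_zpowers_rot (s : Equiv.Perm (Fin 6)) (q : Fin k) :
    ∃ η ∈ zpowers (shift s : Wr k), η.rot = q :=
  ⟨shift s ^ q.val, npow_mem_zpowers _ _, by rw [pow_rot, shift_rot, val_nsmul_one]⟩

theorem dvd_of_zsmul_one {j : ℤ} (h : j • (1 : Fin k) = 0) : (k : ℤ) ∣ j := by
  have h1 : (j % k).toNat • (1 : Fin k) = 0 := by
    have hk : (k : ℤ) ≠ 0 := by exact_mod_cast NeZero.ne k
    rw [← natCast_zsmul, Int.toNat_of_nonneg (Int.emod_nonneg _ hk), Int.emod_def, sub_smul, h,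
      mul_comm, mul_smul, natCast_zsmul, card_nsmul_fin, smul_zero, sub_zero]
  have hk : 0 < (k : ℤ) := by exact_mod_cast Nat.pos_of_ne_zero (NeZero.ne k)
  have h2 := congrArg Fin.val h1
  have h3 := Int.emod_nonneg j hk.ne'
  have h4 := Int.emod_lt_of_pos j hk
  rw [nsmul_one_val, Nat.mod_eq_of_lt (by omega)] at h2
  simp at h2
  exact Int.dvd_of_emod_eq_zero (by omega)

theorem zpow_shift_of_rot {s : Equiv.Perm (Fin 6)} {j : ℤ}
    (h : ((shift s : Wr k) ^ j).rot = 0) : ∃ m : ℤ, j = k * m ∧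
      (shift s : Wr k) ^ j = ofBase fun _ => s ^ m := by
  rw [zpow_rot, shift_rot] at h
  obtain ⟨m, rfl⟩ := dvd_of_zsmul_one h
  refine ⟨m, rfl, ?_⟩
  rw [zpow_mul, zpow_natCast, shift_pow, ← map_zpow]
  rfl

/-! ### The groups generated by the even part of the base and a twisted rotation -/

/-- The product of `k` copies of the alternating group. -/
def evenBase : Subgroup (Wr k) where
  carrier := {a | a.rot = 0 ∧ ∀ i, sign (a.base i) = 1}
  one_mem' := ⟨rfl, fun i => by simp [one_base]⟩
  mul_mem' := fun {a b} ha hb => ⟨by rw [mul_rot, ha.1, hb.1, add_zero], fun i => by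
    rw [mul_base, map_mul, ha.2, hb.2, one_mul]⟩
  inv_mem' := fun {a} ha => ⟨by rw [inv_rot, ha.1, neg_zero], fun i => by
    rw [inv_base, map_inv, ha.2, inv_one]⟩

theorem ofBase_mem_evenBase {α : Fin k → Equiv.Perm (Fin 6)} :
    ofBase α ∈ evenBase ↔ ∀ i, sign (α i) = 1 := ⟨fun h => h.2, fun h => ⟨rfl, h⟩⟩

instance : (evenBase : Subgroup (Wr k)).Normal := ⟨fun a ha g => by
  rw [eq_ofBase ha.1, conj_ofBase, ofBase_mem_evenBase]
  intro i
  simp [ha.2]⟩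

/-- The group generated by `evenBase` and `shift s`. -/
def grp (k : ℕ) [NeZero k] (s : Equiv.Perm (Fin 6)) : Subgroup (Wr k) :=
  evenBase ⊔ zpowers (shift s)

theorem evenBase_le {s : Equiv.Perm (Fin 6)} : evenBase ≤ grp k s := le_sup_left

theorem zpowers_le_grp {s : Equiv.Perm (Fin 6)} : zpowers (shift s) ≤ grp k s := le_sup_right

theorem shift_mem {s : Equiv.Perm (Fin 6)} : shift s ∈ grp k s :=
  zpowers_le_grp (mem_zpowers _)

theorem mem_grp_iff {s : Equiv.Perm (Fin 6)} {a : Wr k} : a ∈ grp k s ↔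
    ∃ η ∈ zpowers (shift s : Wr k), η.rot = a.rot ∧ ∀ i, sign (a.base i) = sign (η.base i) := by
  constructor
  · intro h
    obtain ⟨n, hn, η, hη, rfl⟩ := mem_sup_of_normal_left.1 h
    exact ⟨η, hη, by rw [mul_rot, hn.1, zero_add], fun i => by
      rw [mul_base, map_mul, hn.1, hn.2, one_mul, sub_zero]⟩
  · rintro ⟨η, hη, hr, hs⟩
    have h : a * η⁻¹ ∈ grp k s := evenBase_le ⟨by rw [mul_rot, inv_rot, hr, add_neg_cancel],
      fun i => by rw [mul_base, inv_base, hr, sub_add_cancel, map_mul, map_inv, hs, mul_inv_cancel]⟩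
    simpa using mul_mem h (zpowers_le_grp hη)

theorem grp_eq {s t : Equiv.Perm (Fin 6)} (h : sign s = sign t) : grp k s = grp k t := by
  have key : ∀ s t : Equiv.Perm (Fin 6), sign s = sign t → grp k s ≤ grp k t := by
    intro s t h
    refine sup_le evenBase_le ?_
    rw [zpowers_le, mem_grp_iff]
    refine ⟨shift t, mem_zpowers _, rfl, fun i => ?_⟩
    by_cases hi : i = 0
    · rw [hi, shift_base_zero, shift_base_zero, h]
    · rw [shift_base_of_ne _ hi, shift_base_of_ne _ hi]
  exact le_antisymm (key s t h) (key t s h.symm)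

theorem sign_base_eq {s : Equiv.Perm (Fin 6)} {a : Wr k} (ha : a ∈ grp k s) (h : a.rot = 0)
    (i j : Fin k) : sign (a.base i) = sign (a.base j) := by
  obtain ⟨η, hη, hr, hs⟩ := mem_grp_iff.1 ha
  obtain ⟨n, rfl⟩ := mem_zpowers_iff.1 hη
  obtain ⟨m, -, hm⟩ := zpow_shift_of_rot (hr.trans h)
  rw [hs, hs, hm, ofBase_base]

/-- Applying an automorphism to all coordinates. -/
def mapBase (f : Equiv.Perm (Fin 6) ≃* Equiv.Perm (Fin 6)) : Wr k ≃* Wr k where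
  toFun a := ⟨fun i => f (a.base i), a.rot⟩
  invFun a := ⟨fun i => f.symm (a.base i), a.rot⟩
  left_inv a := by simp
  right_inv a := by simp
  map_mul' a b := Wr.ext (by funext i; simp [mul_base]) rfl

theorem mapBase_base {k : ℕ} (f : Equiv.Perm (Fin 6) ≃* Equiv.Perm (Fin 6)) (a : Wr k)
    (i : Fin k) : (mapBase f a).base i = f (a.base i) := rfl

theorem mapBase_rot {k : ℕ} (f : Equiv.Perm (Fin 6) ≃* Equiv.Perm (Fin 6)) (a : Wr k) :
    (mapBase f a).rot = a.rot := rfl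

theorem mapBase_mem {f : Equiv.Perm (Fin 6) ≃* Equiv.Perm (Fin 6)}
    (hf : ∀ x, sign (f x) = sign x) {s : Equiv.Perm (Fin 6)} {a : Wr k} :
    mapBase f a ∈ grp k s ↔ a ∈ grp k s := by
  simp only [mem_grp_iff, mapBase_rot, mapBase_base, hf]

theorem map_mapBase {f : Equiv.Perm (Fin 6) ≃* Equiv.Perm (Fin 6)}
    (hf : ∀ x, sign (f x) = sign x) (s : Equiv.Perm (Fin 6)) :
    (grp k s).map (mapBase f).toMonoidHom = grp k s := by
  ext a
  constructor
  · rintro ⟨b, hb, rfl⟩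
    exact (mapBase_mem hf).2 hb
  · intro ha
    refine ⟨(mapBase f).symm a, (mapBase_mem hf).1 ?_, (mapBase f).apply_symm_apply a⟩
    rwa [(mapBase f).apply_symm_apply]

section Generation

variable {H : Subgroup (Wr k)} {s : Equiv.Perm (Fin 6)} {β : Fin k → Equiv.Perm (Fin 6)}

theorem exists_mem_apply_eq (hs : shift s ∈ H) (hβ : ofBase β ∈ H)
    (hgen : closure ({s} ∪ Set.range β) = ⊤) (e : Fin k) (x : Equiv.Perm (Fin 6)) :
    ∃ d, ofBase d ∈ H ∧ d e = x := by
  let P : Fin k → Subgroup (Equiv.Perm (Fin 6)) := fun i =>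
    (H.comap ofBase).map (Pi.evalMonoidHom (fun _ : Fin k => Equiv.Perm (Fin 6)) i)
  have hstep : ∀ i : Fin k, i ≠ 0 → P i = P (i - 1) := by
    intro i hi
    apply le_antisymm
    · rintro _ ⟨d, hd, rfl⟩
      refine ⟨fun j => (shift s : Wr k)⁻¹.base j * d (j - (shift s : Wr k)⁻¹.rot) *
        ((shift s : Wr k)⁻¹.base j)⁻¹, ?_, ?_⟩
      · rw [SetLike.mem_coe, mem_comap, ← conj_ofBase]
        exact mul_mem (mul_mem (inv_mem hs) hd) (inv_mem (inv_mem hs))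
      · simp [inv_base, inv_rot, shift_rot, shift_base_of_ne s hi]
    · rintro _ ⟨d, hd, rfl⟩
      refine ⟨fun j => (shift s : Wr k).base j * d (j - (shift s : Wr k).rot) *
        ((shift s : Wr k).base j)⁻¹, ?_, ?_⟩
      · rw [SetLike.mem_coe, mem_comap, ← conj_ofBase]
        exact mul_mem (mul_mem hs hd) (inv_mem hs)
      · simp [shift_rot, shift_base_of_ne s hi]
  have hP0 : ∀ n (i : Fin k), i.val = n → P i = P 0 := by
    intro n
    induction n with
    | zero => intro i hi; rw [show i = 0 from Fin.ext hi]
    | succ n ih =>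
      intro i hi
      have hi0 : i ≠ 0 := fun h => by rw [h] at hi; simp at hi
      rw [hstep i hi0]
      exact ih _ (by rw [Fin.val_sub_one_of_ne_zero hi0, hi]; rfl)
  have htop : P e = ⊤ := by
    rw [hP0 _ e rfl, eq_top_iff, ← hgen, closure_le]
    rintro y (rfl | ⟨i, rfl⟩)
    · refine ⟨fun _ => y, ?_, rfl⟩
      rw [SetLike.mem_coe, mem_comap, ← shift_pow]
      exact pow_mem hs k
    · rw [← hP0 _ i rfl]
      exact ⟨β, hβ, rfl⟩
  obtain ⟨d, hd, h⟩ := (htop ▸ mem_top x : x ∈ P e)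
  exact ⟨d, hd, h⟩

/-- The even part of the intersection of `H` with the base group. -/
def evenPart (H : Subgroup (Wr k)) : Subgroup (Fin k → Equiv.Perm (Fin 6)) :=
  (H ⊓ evenBase).comap ofBase

theorem mem_evenPart {d : Fin k → Equiv.Perm (Fin 6)} :
    d ∈ evenPart H ↔ ofBase d ∈ H ∧ ∀ i, sign (d i) = 1 :=
  and_congr_right' ofBase_mem_evenBase

theorem conj_mem_evenPart {d p : Fin k → Equiv.Perm (Fin 6)} (hd : d ∈ evenPart H)
    (hp : ofBase p ∈ H) : p * d * p⁻¹ ∈ evenPart H := by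
  rw [mem_evenPart] at hd ⊢
  refine ⟨?_, fun i => by simp [hd.2]⟩
  rw [map_mul, map_mul, map_inv]
  exact mul_mem (mul_mem hp hd.1) (inv_mem hp)

theorem sign_commutator (a b : Equiv.Perm (Fin 6)) : sign (a * b * a⁻¹ * b⁻¹) = 1 := by
  simp only [map_mul, map_inv]
  rw [mul_right_comm (sign a), mul_inv_cancel, one_mul, mul_inv_cancel]

theorem commutator_mem_evenPart {d p : Fin k → Equiv.Perm (Fin 6)} (hd : ofBase d ∈ H)
    (hp : ofBase p ∈ H) : d * p * d⁻¹ * p⁻¹ ∈ evenPart H := by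
  rw [mem_evenPart]
  refine ⟨?_, fun i => sign_commutator _ _⟩
  rw [map_mul, map_mul, map_mul, map_inv, map_inv]
  exact mul_mem (mul_mem (mul_mem hd hp) (inv_mem hd)) (inv_mem hp)

theorem exists_mem_evenPart (hD : ∀ e x, ∃ d, ofBase d ∈ H ∧ d e = x) (e : Fin k)
    {x : Equiv.Perm (Fin 6)} (hx : sign x = 1) : ∃ d ∈ evenPart H, d e = x := by
  let K := (evenPart H).map (Pi.evalMonoidHom (fun _ : Fin k => Equiv.Perm (Fin 6)) e)
  obtain ⟨y, -, hy⟩ := exists_not_commute (x := v) (by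
    intro h; have := sign_v; rw [h] at this; exact absurd this (by decide))
  obtain ⟨d, hd, hde⟩ := hD e v
  obtain ⟨p, hp, hpe⟩ := hD e y
  have hc := commutator_mem_evenPart hd hp
  refine mem_of_sign_eq_one (K := K) ?_ (z := v * y * v⁻¹ * y⁻¹) ⟨_, hc, ?_⟩ ?_ ?_ hx
  · rintro g - _ ⟨d, hd, rfl⟩
    obtain ⟨p, hp, rfl⟩ := hD e g
    exact ⟨_, conj_mem_evenPart hd hp, by simp⟩
  · simp [hde, hpe]
  · exact sign_commutator _ _
  · intro h
    rw [mul_inv_eq_one, mul_inv_eq_iff_eq_mul] at h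
    exact hy h

theorem exists_separating (hD : ∀ e x, ∃ d, ofBase d ∈ H ∧ d e = x)
    {z : Fin k → Equiv.Perm (Fin 6)} (hz : ofBase z ∈ H) {a b : Fin k} (ha : z a = 1)
    (hb : z b ≠ 1) : ∃ d ∈ evenPart H, d a = 1 ∧ d b ≠ 1 := by
  obtain ⟨y, hy, hne⟩ := exists_not_commute hb
  obtain ⟨p, hp, rfl⟩ := exists_mem_evenPart hD b hy
  refine ⟨_, commutator_mem_evenPart hz (mem_evenPart.1 hp).1, by simp [ha], fun h => hne ?_⟩
  simp only [Pi.mul_apply, Pi.inv_apply] at h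
  rwa [mul_inv_eq_one, mul_inv_eq_iff_eq_mul] at h

theorem separating_symm (hD : ∀ e x, ∃ d, ofBase d ∈ H ∧ d e = x) {a b : Fin k}
    (h : ∃ d ∈ evenPart H, d a = 1 ∧ d b ≠ 1) : ∃ d ∈ evenPart H, d b = 1 ∧ d a ≠ 1 := by
  obtain ⟨d, hd, ha, hb⟩ := h
  let E := Pi.evalMonoidHom (fun _ : Fin k => Equiv.Perm (Fin 6))
  let K := (evenPart H ⊓ (E a).ker).map (E b)
  obtain ⟨x, hx, hx1⟩ : ∃ x : Equiv.Perm (Fin 6), sign x = 1 ∧ x ≠ 1 :=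
    ⟨d b, (mem_evenPart.1 hd).2 b, hb⟩
  obtain ⟨p, hp, rfl⟩ := exists_mem_evenPart hD a hx
  obtain ⟨q, ⟨hq, hqa⟩, hqb⟩ : p b ∈ K := by
    refine mem_of_sign_eq_one (K := K) ?_ (z := d b) ⟨d, ⟨hd, ha⟩, rfl⟩ ((mem_evenPart.1 hd).2 b) hb
      ((mem_evenPart.1 hp).2 b)
    rintro g - _ ⟨d, ⟨hd, hda⟩, rfl⟩
    obtain ⟨r, hr, rfl⟩ := hD b g
    refine ⟨_, ⟨conj_mem_evenPart hd hr, ?_⟩, by simp [E]⟩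
    have : d a = 1 := hda
    change _ = _
    simp [E, this]
  refine ⟨p * q⁻¹, mul_mem hp (inv_mem hq), ?_, ?_⟩
  · rw [Pi.mul_apply, Pi.inv_apply, show q b = p b from hqb, mul_inv_cancel]
  · rw [Pi.mul_apply, Pi.inv_apply, show q a = 1 from hqa, inv_one, mul_one]
    exact hx1

theorem exists_supported (hD : ∀ e x, ∃ d, ofBase d ∈ H ∧ d e = x) {c : Fin k}
    (h : ∀ e, e ≠ c → ∃ d ∈ evenPart H, d e = 1 ∧ d c ≠ 1) (S : Finset (Fin k)) (hS : c ∉ S) :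
    ∃ d ∈ evenPart H, d c ≠ 1 ∧ ∀ e ∈ S, d e = 1 := by
  induction S using Finset.induction_on with
  | empty =>
    obtain ⟨x, hx, hne⟩ := exists_not_commute (x := v) (by
      intro h; have := sign_v; rw [h] at this; exact absurd this (by decide))
    obtain ⟨d, hd, rfl⟩ := exists_mem_evenPart hD c hx
    exact ⟨d, hd, fun h => hne (by rw [h, mul_one, one_mul]), by simp⟩
  | insert e S he ih =>
    rw [Finset.mem_insert, not_or] at hS
    obtain ⟨d, hd, hdc, hdS⟩ := ih hS.2
    obtain ⟨d', hd', hd'e, hd'c⟩ := h e (Ne.symm hS.1)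
    obtain ⟨g, hg, hne⟩ := exists_conj_not_commute hdc hd'c ((mem_evenPart.1 hd').2 c)
    obtain ⟨p, hp, rfl⟩ := exists_mem_evenPart hD c hg
    have hp' := conj_mem_evenPart hd' (mem_evenPart.1 hp).1
    refine ⟨_, commutator_mem_evenPart (mem_evenPart.1 hd).1 (mem_evenPart.1 hp').1, ?_, ?_⟩
    · intro h
      simp only [Pi.mul_apply, Pi.inv_apply] at h
      rw [mul_inv_eq_one, mul_inv_eq_iff_eq_mul] at h
      exact hne h
    · intro i hi
      rcases Finset.mem_insert.1 hi with rfl | hi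
      · simp [hd'e]
      · simp [hdS i hi]

/-- A subgroup containing `shift s` and an element `β` of the base is large when `s` and the
coordinates of `β` generate, and one coordinate of `β` is distinguished from all the others. -/
theorem grp_le (hs : shift s ∈ H) (hβ : ofBase β ∈ H) (hgen : closure ({s} ∪ Set.range β) = ⊤)
    (c : Fin k) (hsep : ∀ e, e ≠ c → Sep s (β c) (β e)) : grp k s ≤ H := by
  have hD := exists_mem_apply_eq hs hβ hgen
  have hconst : ofBase (fun _ => s) ∈ H := shift_pow (k := k) s ▸ pow_mem hs k
  have h1 : ∀ e, e ≠ c → ∃ d ∈ evenPart H, d e = 1 ∧ d c ≠ 1 := by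
    intro e he
    obtain ⟨j, n, hjn⟩ := hsep e he
    have hz : ofBase ((β * (fun _ => s) ^ j) ^ n) ∈ H := by
      rw [map_pow, map_mul, map_pow]
      exact pow_mem (mul_mem hβ (pow_mem hconst j)) n
    by_cases h : (β e * s ^ j) ^ n = 1
    · exact exists_separating hD hz h fun h' => hjn ⟨fun _ => h, fun _ => h'⟩
    · refine separating_symm hD (exists_separating hD hz (a := c) ?_ h)
      by_contra h'
      exact hjn ⟨fun h2 => absurd h2 h', fun h2 => absurd h2 h⟩
  obtain ⟨d, hd, hdc, hde⟩ := exists_supported hD h1 (Finset.univ.erase c) (by simp)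
  have hsingle : d = Pi.mulSingle c (d c) := by
    funext i
    by_cases hi : i = c
    · subst hi; simp
    · rw [Pi.mulSingle_eq_of_ne hi, hde i (by simp [hi])]
  let K := H.comap (ofBase.comp (MonoidHom.mulSingle (fun _ : Fin k => Equiv.Perm (Fin 6)) c))
  have hK : ∀ x, sign x = 1 → ofBase (Pi.mulSingle c x) ∈ H := by
    intro x hx
    refine mem_of_sign_eq_one (K := K) ?_ (z := d c) ?_ ((mem_evenPart.1 hd).2 c) hdc hx
    · intro g _ z hz
      obtain ⟨p, hp, rfl⟩ := hD c g
      have := mul_mem (mul_mem hp (show ofBase (Pi.mulSingle c z) ∈ H from hz)) (inv_mem hp)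
      rw [conj_ofBase] at this
      show ofBase (Pi.mulSingle c (p c * z * (p c)⁻¹)) ∈ H
      convert this using 2
      funext i
      rw [ofBase_rot, ofBase_base, sub_zero]
      by_cases hi : i = c
      · subst hi; simp
      · simp [Pi.mulSingle_eq_of_ne hi]
    · show ofBase (Pi.mulSingle c (d c)) ∈ H
      exact hsingle ▸ (mem_evenPart.1 hd).1
  have hall : ∀ e x, sign x = 1 → ofBase (Pi.mulSingle e x) ∈ H := by
    intro e x hx
    obtain ⟨η, hη, hr⟩ := exists_zpowers_rot (k := k) s (e - c)
    have hηH : η ∈ H := (zpowers_le.2 hs) hη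
    have := mul_mem (mul_mem hηH (hK ((η.base e)⁻¹ * x * η.base e) (by
      simp [hx]))) (inv_mem hηH)
    rw [conj_ofBase, hr] at this
    convert this using 2
    funext i
    by_cases hi : i = e
    · subst hi; simp [mul_assoc]
    · rw [Pi.mulSingle_eq_of_ne hi, Pi.mulSingle_eq_of_ne (by
        intro h; apply hi; rw [sub_eq_iff_eq_add] at h; simpa using h)]
      simp
  refine sup_le ?_ (zpowers_le.2 hs)
  intro a ha
  rw [eq_ofBase ha.1]
  exact pi_mem_of_mulSingle_mem (H := H.comap ofBase) _ fun i => hall i _ (ha.2 i)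

end Generation

/-- The coordinates of `γ a γ⁻¹ η⁻¹`, where `γ = ofBase g` and `a`, `η` have the same rotation. -/
def coord (a η : Wr k) (g : Fin k → Equiv.Perm (Fin 6)) (e : Fin k) : Equiv.Perm (Fin 6) :=
  g e * a.base e * (g (e - a.rot))⁻¹ * (η.base e)⁻¹

theorem ofBase_coord {a η : Wr k} (h : η.rot = a.rot) (g : Fin k → Equiv.Perm (Fin 6)) :
    ofBase (coord a η g) = ofBase g * a * (ofBase g)⁻¹ * η⁻¹ := by
  rw [ofBase_conj]
  refine Wr.ext ?_ ?_
  · funext i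
    simp [mul_base, inv_base, ofBase_base, coord, h]
  · simp [mul_rot, inv_rot, ofBase_rot, h]

theorem coord_congr {k : ℕ} {a η : Wr k} {g g' : Fin k → Equiv.Perm (Fin 6)}
    {e : Fin k}
    (h : g e = g' e) (h' : g (e - a.rot) = g' (e - a.rot)) : coord a η g e = coord a η g' e := by
  rw [coord, coord, h, h']

/-- `shift v` conjugated by an element of the base. -/
def mate (g : Fin k → Equiv.Perm (Fin 6)) : Wr k := (ofBase g)⁻¹ * shift v * ofBase g

theorem mate_mem {g : Fin k → Equiv.Perm (Fin 6)} (hg : ∀ i, sign (g i) = 1) :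
    mate g ∈ grp k v := by
  have h := evenBase_le (s := v) (ofBase_mem_evenBase.2 hg)
  exact mul_mem (mul_mem (inv_mem h) shift_mem) h

theorem closure_mate {a η : Wr k} (ha : a ∈ grp k v) (hη : η ∈ zpowers (shift v))
    (hr : η.rot = a.rot) {g : Fin k → Equiv.Perm (Fin 6)} (hg : ∀ i, sign (g i) = 1) (c : Fin k)
    (hc : ∀ e, e ≠ c → inv3 (coord a η g e) ≠ inv3 (coord a η g c))
    (hgen : closure ({v} ∪ Set.range (coord a η g)) = ⊤) :
    closure {a, mate g} = grp k v := by
  have hγ := evenBase_le (s := v) (ofBase_mem_evenBase.2 hg)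
  apply le_antisymm
  · rw [closure_le]
    rintro _ (rfl | rfl)
    exacts [ha, mate_mem hg]
  let H := (closure {a, mate g}).map (MulAut.conj (ofBase g)).toMonoidHom
  have hs : shift v ∈ H := by
    refine ⟨mate g, subset_closure (by simp), ?_⟩
    simp [mate, mul_assoc]
  have hH : grp k v ≤ H := by
    refine grp_le hs (β := coord a η g) ?_ hgen c fun e he => sep_of_inv3_ne (hc e he).symm
    rw [ofBase_coord hr]
    exact mul_mem ⟨a, subset_closure (by simp), rfl⟩ (inv_mem (zpowers_le.2 hs hη))
  intro b hb
  obtain ⟨z, hz, h⟩ := hH (mul_mem (mul_mem hγ hb) (inv_mem hγ))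
  have : z = b := (MulAut.conj (ofBase g)).injective h
  exact this ▸ hz

/-- At every coordinate, less than half of the even permutations can produce a coordinate with
invariant `r`. -/
def Thin (a η : Wr k) (r : ℕ) : Prop :=
  ∀ g : Fin k → Equiv.Perm (Fin 6), (∀ i, sign (g i) = 1) → ∀ i, evenCard (fun u =>
    ∃ e, (e = i ∨ e - a.rot = i) ∧ inv3 (coord a η (Function.update g i u) e) = r) < 180

theorem exists_extend {k : ℕ} {a η a' η' : Wr k} {r r' : ℕ} {c c' : Fin k} (ht : Thin a η r)
    (ht' : Thin a' η' r') {S : Finset (Fin k)} {g : Fin k → Equiv.Perm (Fin 6)}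
    (hg : ∀ i, sign (g i) = 1)
    (hS : ∀ e ∈ S, e - a.rot ∈ S → e ≠ c → inv3 (coord a η g e) ≠ r)
    (hS' : ∀ e ∈ S, e - a'.rot ∈ S → e ≠ c' → inv3 (coord a' η' g e) ≠ r') :
    ∃ g' : Fin k → Equiv.Perm (Fin 6), (∀ i, sign (g' i) = 1) ∧ (∀ i ∈ S, g' i = g i) ∧
      (∀ e, e ≠ c → inv3 (coord a η g' e) ≠ r) ∧
      ∀ e, e ≠ c' → inv3 (coord a' η' g' e) ≠ r' := by
  have key : ∀ T : Finset (Fin k), ∃ g' : Fin k → Equiv.Perm (Fin 6),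
      (∀ i, sign (g' i) = 1) ∧ (∀ i ∈ S, g' i = g i) ∧
      (∀ e ∈ S ∪ T, e - a.rot ∈ S ∪ T → e ≠ c → inv3 (coord a η g' e) ≠ r) ∧
      ∀ e ∈ S ∪ T, e - a'.rot ∈ S ∪ T → e ≠ c' → inv3 (coord a' η' g' e) ≠ r' := by
    intro T
    induction T using Finset.induction_on with
    | empty => exact ⟨g, hg, fun _ _ => rfl, by simpa using hS, by simpa using hS'⟩
    | insert i T _ ih =>
      obtain ⟨g', hs, hag, h1, h2⟩ := ih
      rw [Finset.union_insert]
      by_cases hi : i ∈ S ∪ T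
      · rw [Finset.insert_eq_of_mem hi]
        exact ⟨g', hs, hag, h1, h2⟩
      obtain ⟨u, hu, hu1, hu2⟩ := exists_even_avoiding
        (add_lt_add (ht g' hs i) (ht' g' hs i) : _ < 360)
      have hstep : ∀ (b θ : Wr k) (d : Fin k) (t : ℕ),
          (∀ e ∈ S ∪ T, e - b.rot ∈ S ∪ T → e ≠ d → inv3 (coord b θ g' e) ≠ t) →
          (¬∃ e, (e = i ∨ e - b.rot = i) ∧ inv3 (coord b θ (Function.update g' i u) e) = t) →
          ∀ e ∈ insert i (S ∪ T), e - b.rot ∈ insert i (S ∪ T) → e ≠ d →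
            inv3 (coord b θ (Function.update g' i u) e) ≠ t := by
        intro b θ d t h3 h4 e he he' hed h5
        by_cases h6 : e = i ∨ e - b.rot = i
        · exact h4 ⟨e, h6, h5⟩
        · rw [not_or] at h6
          rw [Finset.mem_insert] at he he'
          refine h3 e (he.resolve_left h6.1) (he'.resolve_left h6.2) hed ?_
          rwa [coord_congr (g' := g') (Function.update_of_ne h6.1 _ _)
            (Function.update_of_ne h6.2 _ _)] at h5
      refine ⟨Function.update g' i u, fun j => ?_, fun j hj => ?_, hstep a η c r h1 hu1,
        hstep a' η' c' r' h2 hu2⟩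
      · by_cases hj : j = i
        · subst hj; simpa using hu
        · rw [Function.update_of_ne hj]; exact hs j
      · rw [Function.update_of_ne, hag j hj]
        rintro rfl
        exact hi (Finset.mem_union_left _ hj)
  obtain ⟨g', hs, hag, h1, h2⟩ := key Finset.univ
  exact ⟨g', hs, hag, fun e => h1 e (by simp) (by simp), fun e => h2 e (by simp) (by simp)⟩

/-- The choice of `g` on `S` can be extended to a mate of `a`. -/
def Init (a η : Wr k) (S : Finset (Fin k)) (g : Fin k → Equiv.Perm (Fin 6)) : Prop :=
  ∃ c ∈ S, c - a.rot ∈ S ∧ Thin a η (inv3 (coord a η g c)) ∧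
    (∀ e ∈ S, e - a.rot ∈ S → e ≠ c → inv3 (coord a η g e) ≠ inv3 (coord a η g c)) ∧
    closure ({v} ∪ coord a η g '' {e | e ∈ S ∧ e - a.rot ∈ S}) = ⊤

/-- `a` lies in the group and `η` is a power of `shift v` with the same rotation. -/
def Rotates (a η : Wr k) : Prop := a ∈ grp k v ∧ η ∈ zpowers (shift v) ∧ η.rot = a.rot

/-- Some conjugate of `shift v` generates the group with each of `a` and `a'`. -/
def Mates (a a' : Wr k) : Prop :=
  ∃ g : Fin k → Equiv.Perm (Fin 6), (∀ i, sign (g i) = 1) ∧ closure {a, mate g} = grp k v ∧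
    closure {a', mate g} = grp k v

theorem Init.mates {a η a' η' : Wr k} {S : Finset (Fin k)} {g : Fin k → Equiv.Perm (Fin 6)}
    (h : Init a η S g) (h' : Init a' η' S g) (hg : ∀ i, sign (g i) = 1) (ha : Rotates a η)
    (ha' : Rotates a' η') : Mates a a' := by
  obtain ⟨c, hc, hc', ht, hne, hgen⟩ := h
  obtain ⟨d, hd, hd', ht', hne', hgen'⟩ := h'
  obtain ⟨g', hs, hag, h1, h2⟩ := exists_extend ht ht' hg hne hne'
  have hfin : ∀ (b θ : Wr k) (d : Fin k), Rotates b θ → d ∈ S → d - b.rot ∈ S →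
      (∀ e, e ≠ d → inv3 (coord b θ g' e) ≠ inv3 (coord b θ g d)) →
      closure ({v} ∪ coord b θ g '' {e | e ∈ S ∧ e - b.rot ∈ S}) = ⊤ →
      closure {b, mate g'} = grp k v := by
    intro b θ d hb hd hd' hne hgen
    have hcoord : ∀ e ∈ S, e - b.rot ∈ S → coord b θ g' e = coord b θ g e :=
      fun e he he' => coord_congr (hag e he) (hag _ he')
    refine closure_mate hb.1 hb.2.1 hb.2.2 hs d (by rwa [hcoord d hd hd']) ?_
    rw [eq_top_iff, ← hgen]
    apply Subgroup.closure_mono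
    rintro y (hy | ⟨e, he, rfl⟩)
    · exact Or.inl hy
    · exact Or.inr ⟨e, hcoord e he.1 he.2⟩
  exact ⟨g', hs, hfin a η c ha hc hc' h1 hgen, hfin a' η' d ha' hd hd' h2 hgen'⟩

theorem closure_eq_top_of_good {B : Set (Equiv.Perm (Fin 6))} {σ : Equiv.Perm (Fin 6)}
    (hσ : σ ∈ B) (h : Good σ) : closure ({v} ∪ B) = ⊤ := by
  rw [eq_top_iff, ← h.closure_eq]
  apply Subgroup.closure_mono
  rintro y (rfl | rfl)
  exacts [Or.inl rfl, Or.inr hσ]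

/-- A nontrivial element of the base whose coordinates have prime order or are trivial. -/
structure IsBase (a : Wr k) : Prop where
  mem : a ∈ grp k v
  rot : a.rot = 0
  prime : ∀ i, a.base i = 1 ∨ PrimeOrd (a.base i)
  ne : ∃ i, a.base i ≠ 1

/-- An element whose square lies outside the base. -/
structure IsOuter (a : Wr k) : Prop where
  mem : a ∈ grp k v
  rot : a.rot + a.rot ≠ 0

theorem IsBase.rotates {a : Wr k} (h : IsBase a) : Rotates a 1 :=
  ⟨h.mem, one_mem _, h.rot.symm⟩

theorem IsBase.coord_eq {a : Wr k} (h : IsBase a) (g : Fin k → Equiv.Perm (Fin 6)) (e : Fin k) :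
    coord a 1 g e = g e * a.base e * (g e)⁻¹ := by
  rw [coord, h.rot, sub_zero, one_base, inv_one, mul_one]

theorem IsBase.thin {a : Wr k} (h : IsBase a) {r : ℕ} (hr : inv3 1 ≠ r) : Thin a 1 r := by
  intro g _ i
  have hle : evenCard (fun u => ∃ e, (e = i ∨ e - a.rot = i) ∧
      inv3 (coord a 1 (Function.update g i u) e) = r) ≤
      evenCard (fun u => inv3 (u * a.base i * u⁻¹) = r) := by
    refine evenCard_mono fun u _ ⟨e, he, hu⟩ => ?_
    rw [h.rot, sub_zero, or_self] at he
    subst he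
    rwa [h.coord_eq, Function.update_self] at hu
  refine lt_of_le_of_lt hle ?_
  rcases h.prime i with h1 | h1
  · have : evenCard (fun u => inv3 (u * a.base i * u⁻¹) = r) ≤ 0 := by
      refine le_trans (evenCard_mono (Q := fun _ => False) fun u _ hu => ?_) (by simp [evenCard])
      rw [h1, mul_one, mul_inv_cancel] at hu
      exact hr hu
    omega
  · exact h1.evenCard_inv3 r

theorem IsBase.initial {a : Wr k} (h : IsBase a) {S : Finset (Fin k)}
    {g : Fin k → Equiv.Perm (Fin 6)} {c : Fin k} (hc : c ∈ S)
    (hgood : Good (g c * a.base c * (g c)⁻¹))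
    (hne : ∀ e ∈ S, e ≠ c → inv3 (g e * a.base e * (g e)⁻¹) ≠ inv3 (g c * a.base c * (g c)⁻¹)) :
    Init a 1 S g := by
  refine ⟨c, hc, by rwa [h.rot, sub_zero], h.thin ?_, ?_, ?_⟩
  · rw [h.coord_eq]
    exact inv3_one_ne hgood.ne_one
  · intro e he _ hec
    rw [h.coord_eq, h.coord_eq]
    exact hne e he hec
  · refine closure_eq_top_of_good ⟨c, ⟨hc, by rwa [h.rot, sub_zero]⟩, rfl⟩ ?_
    rwa [h.coord_eq]

/-- `η` is a power of `shift v` in the coset of `a` modulo the even part of the base. -/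
structure Companion (a η : Wr k) : Prop where
  mem : a ∈ grp k v
  zpow : η ∈ zpowers (shift v)
  rot : η.rot = a.rot
  sign : ∀ i, sign (a.base i) = sign (η.base i)

theorem exists_companion {a : Wr k} (ha : a ∈ grp k v) : ∃ η, Companion a η := by
  obtain ⟨η, h1, h2, h3⟩ := mem_grp_iff.1 ha
  exact ⟨η, ha, h1, h2, h3⟩

theorem Companion.rotates {a η : Wr k} (h : Companion a η) : Rotates a η := ⟨h.mem, h.zpow, h.rot⟩

theorem Companion.sign_coord {a η : Wr k} (h : Companion a η) {g : Fin k → Equiv.Perm (Fin 6)}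
    (hg : ∀ i, Equiv.Perm.sign (g i) = 1) (e : Fin k) :
    Equiv.Perm.sign (coord a η g e) = 1 := by
  simp [coord, hg, h.sign]

theorem evenCard_translate_le {P : Equiv.Perm (Fin 6) → Prop} (x y : Equiv.Perm (Fin 6))
    (h : sign x = sign y) : evenCard (fun u => P (x * u * y)) ≤ evenCard P := by
  refine evenCard_comp_le (fun u => x * u * y) (fun u w he => ?_) fun u hu => ?_
  · simpa using he
  · simp [h, hu]

theorem evenCard_translate_inv_le {P : Equiv.Perm (Fin 6) → Prop} (x y : Equiv.Perm (Fin 6))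
    (h : sign x = sign y) : evenCard (fun u => P (x * u⁻¹ * y)) ≤ evenCard P := by
  refine evenCard_comp_le (fun u => x * u⁻¹ * y) (fun u w he => ?_) fun u hu => ?_
  · simpa using he
  · simp [h, hu]

theorem Companion.evenCard_left_le {a η : Wr k} (h : Companion a η) (h0 : a.rot ≠ 0)
    {g : Fin k → Equiv.Perm (Fin 6)} (hg : ∀ i, Equiv.Perm.sign (g i) = 1) (i : Fin k)
    (P : Equiv.Perm (Fin 6) → Prop) :
    evenCard (fun u => P (coord a η (Function.update g i u) i)) ≤ evenCard P := by
  refine le_trans (evenCard_mono fun u _ hu => ?_)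
    (evenCard_translate_le 1 (a.base i * (g (i - a.rot))⁻¹ * (η.base i)⁻¹) (by
      simp [hg, h.sign]))
  rw [coord, Function.update_self, Function.update_of_ne (by simpa using h0)] at hu
  simpa [mul_assoc] using hu

theorem Companion.evenCard_right_le {a η : Wr k} (h : Companion a η) (h0 : a.rot ≠ 0)
    {g : Fin k → Equiv.Perm (Fin 6)} (hg : ∀ i, Equiv.Perm.sign (g i) = 1) {i e : Fin k}
    (hi : e - a.rot = i) (P : Equiv.Perm (Fin 6) → Prop) :
    evenCard (fun u => P (coord a η (Function.update g i u) e)) ≤ evenCard P := by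
  refine le_trans (evenCard_mono fun u _ hu => ?_)
    (evenCard_translate_inv_le (g e * a.base e) (η.base e)⁻¹ (by simp [hg, h.sign]))
  rwa [coord, hi, Function.update_self, Function.update_of_ne (by
    rw [← hi]; intro h; apply h0; simpa using h.symm)] at hu

theorem Companion.thin {a η : Wr k} (h : Companion a η) (h0 : a.rot ≠ 0)
    {ρ : Equiv.Perm (Fin 6)} (hρ : Good ρ) (hs : Equiv.Perm.sign ρ = 1) :
    Thin a η (inv3 ρ) := by
  intro g hg i
  have h1 := h.evenCard_left_le h0 hg i fun x => inv3 x = inv3 ρ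
  have h2 := h.evenCard_right_le h0 hg (i := i) (e := i + a.rot) (by simp)
    fun x => inv3 x = inv3 ρ
  have h3 := evenCard_inv3_good hs hρ
  have h4 := evenCard_or_le (fun u => inv3 (coord a η (Function.update g i u) i) = inv3 ρ)
    fun u => inv3 (coord a η (Function.update g i u) (i + a.rot)) = inv3 ρ
  refine lt_of_le_of_lt (evenCard_mono (Q := fun u =>
    inv3 (coord a η (Function.update g i u) i) = inv3 ρ ∨
    inv3 (coord a η (Function.update g i u) (i + a.rot)) = inv3 ρ) fun u _ => ?_) (by omega)
  rintro ⟨e, rfl | he, hu⟩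
  · exact Or.inl hu
  · rw [sub_eq_iff_eq_add.1 he] at hu
    exact Or.inr hu

theorem Companion.initial {a η : Wr k} (h : Companion a η) (h0 : a.rot ≠ 0) {S : Finset (Fin k)}
    {g : Fin k → Equiv.Perm (Fin 6)} (hg : ∀ i, Equiv.Perm.sign (g i) = 1) {c : Fin k}
    (hc : c ∈ S) (hc' : c - a.rot ∈ S) (hgood : Good (coord a η g c))
    (hne : ∀ e ∈ S, e - a.rot ∈ S → e ≠ c → inv3 (coord a η g e) ≠ inv3 (coord a η g c)) :
    Init a η S g :=
  ⟨c, hc, hc', h.thin h0 hgood (h.sign_coord hg c), hne,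
    closure_eq_top_of_good ⟨c, ⟨hc, hc'⟩, rfl⟩ hgood⟩

theorem exists_isBase_or_isOuter {a : Wr k} (ha : a ∈ grp k v) (h1 : a ≠ 1) :
    ∃ n : ℕ, IsBase (a ^ n) ∨ IsOuter (a ^ n) := by
  have hbase : ∀ b ∈ grp k v, b.rot = 0 → b ≠ 1 → ∃ n : ℕ, IsBase (b ^ n) := by
    intro b hb h0 hb1
    obtain ⟨n, hn1, hn⟩ := exists_pow_of_pow_eq_one hb1 (by
      rw [eq_ofBase h0, ← map_pow, show b.base ^ 720 = 1 from funext fun i => perm_pow _, map_one])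
    have hrot : (b ^ n).rot = 0 := by rw [pow_rot, h0, smul_zero]
    refine ⟨n, pow_mem hb n, hrot, fun i => ?_, ?_⟩
    · rw [or_iff_not_imp_left]
      intro hi
      refine ⟨hi, ?_⟩
      have key : ∀ m : ℕ, (b ^ n) ^ m = 1 → (b ^ n).base i ^ m = 1 := by
        intro m hm
        rw [eq_ofBase hrot, ← map_pow] at hm
        exact congrArg (fun z : Wr k => z.base i) hm
      exact hn.imp (key 2) (Or.imp (key 3) (key 5))
    · by_contra! hall
      exact hn1 (Wr.ext (funext hall) hrot)
  by_cases h0 : a.rot + a.rot = 0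
  · by_cases hr : a.rot = 0
    · obtain ⟨n, hn⟩ := hbase a ha hr h1
      exact ⟨n, Or.inl hn⟩
    · obtain ⟨n, hn⟩ := hbase (a ^ 2) (pow_mem ha 2) (by rw [pow_rot, two_nsmul, h0]) (by
        intro h
        obtain ⟨η, hη⟩ := exists_companion ha
        obtain ⟨j, hj⟩ := mem_zpowers_iff.1 hη.zpow
        have hj2 : ((shift v : Wr k) ^ (j * 2)).rot = 0 := by
          rw [zpow_mul, hj, zpow_ofNat, pow_rot, hη.rot, two_nsmul, h0]
        obtain ⟨m, hm, hpow⟩ := zpow_shift_of_rot hj2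
        have hs : sign ((a ^ 2).base 0) = sign ((η ^ 2).base 0) := by
          rw [pow_two, pow_two, mul_base, mul_base, map_mul, map_mul, hη.sign, hη.sign, hη.rot]
        rw [h, ← zpow_ofNat, ← hj, ← zpow_mul, hpow, one_base, ofBase_base] at hs
        rw [map_one, map_zpow, sign_v] at hs
        rcases Int.even_or_odd m with hm2 | hm2
        · obtain ⟨l, rfl⟩ := hm2
          apply hr
          have hjl : j = k * l := by
            have : j * 2 = (k * l) * 2 := by rw [hm]; ring
            omega
          rw [← hη.rot, ← hj, hjl, zpow_mul, zpow_natCast, shift_pow, zpow_rot, ofBase_rot,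
            smul_zero]
        · rw [hm2.neg_one_zpow] at hs
          exact absurd hs (by decide))
      exact ⟨2 * n, Or.inl (by rwa [pow_mul])⟩
  · exact ⟨1, Or.inr ⟨by rwa [pow_one], by rwa [pow_one]⟩⟩

theorem closure_pair_of_pow {X : Type*} [Group X] {M : Subgroup X} {a w : X} {n : ℕ} (ha : a ∈ M)
    (hw : w ∈ M) (h : closure {a ^ n, w} = M) : closure {a, w} = M := by
  apply le_antisymm
  · rw [closure_le]
    rintro _ (rfl | rfl)
    exacts [ha, hw]
  · rw [← h, closure_le]
    rintro _ (rfl | rfl)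
    exacts [pow_mem (subset_closure (by simp)) n, subset_closure (by simp)]

end Wr

theorem PrimeOrd.sign_of_typ {x : Equiv.Perm (Fin 6)} (ht : typ x = 34) : sign x = -1 :=
  (isSwap_of_fx (fx_eq_four_of_typ ht)).sign_eq

theorem PrimeOrd.typ_out_of_swap {x : Equiv.Perm (Fin 6)} (hx : PrimeOrd x) (ht : typ x = 34) :
    typ (S6.out x) = 2 := by
  have h : ∀ p ∈ typeMap, p.1 = 34 → p.2 = 2 := by decide
  exact h _ hx.typ_out ht

theorem PrimeOrd.sign_of_typ_two {x : Equiv.Perm (Fin 6)} (hx : PrimeOrd x) (ht : typ x = 2) :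
    sign x = -1 := by
  have h : ∀ p ∈ typeMap, p.1 = 2 → p.2 = 34 := by decide
  rw [← sign_out]
  exact sign_of_typ (h _ hx.typ_out ht)

theorem inv3_ne_of_one_or_swap {x ρ : Equiv.Perm (Fin 6)} (u : Equiv.Perm (Fin 6))
    (hx : x = 1 ∨ PrimeOrd x ∧ typ x = 34) (hρ : PrimeOrd ρ) (hg : Good ρ) :
    inv3 (u * x * u⁻¹) ≠ inv3 ρ := by
  rcases hx with rfl | ⟨hx, ht⟩
  · rw [mul_one, mul_inv_cancel]
    exact inv3_one_ne hg.ne_one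
  · exact inv3_ne_of_swap (hx.conj u) ((typ_conj u x).trans ht) hρ hg

namespace Wr

variable {k : ℕ} [NeZero k]

theorem IsBase.exists_prime {a : Wr k} (h : IsBase a) : ∃ c, PrimeOrd (a.base c) := by
  obtain ⟨c, hc⟩ := h.ne
  exact ⟨c, (h.prime c).resolve_left hc⟩

theorem IsBase.sign_eq {a : Wr k} (h : IsBase a) (i j : Fin k) :
    sign (a.base i) = sign (a.base j) := sign_base_eq h.mem h.rot i j

theorem IsBase.prime_of_sign {a : Wr k} (h : IsBase a) {c : Fin k} (hc : sign (a.base c) = -1)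
    (i : Fin k) : PrimeOrd (a.base i) := by
  refine (h.prime i).resolve_left fun hi => ?_
  rw [h.sign_eq c i, hi, map_one] at hc
  exact absurd hc (by decide)

theorem IsBase.mates_of_compat {a a' : Wr k} (h : IsBase a) (h' : IsBase a') {c : Fin k}
    (hc : Compat (a.base c) (a'.base c)) : Mates a a' := by
  obtain ⟨u, hu, h1, h2⟩ := hc
  exact (h.initial (S := {c}) (g := fun _ => u) (by simp) h1 (by simp)).mates
    (h'.initial (by simp) h2 (by simp)) (fun _ => hu) h.rotates h'.rotates

theorem IsBase.mates_of_swap_or_one {a a' : Wr k} (h : IsBase a) (h' : IsBase a') {c d : Fin k}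
    (hcd : c ≠ d) (hc : PrimeOrd (a.base c)) (htc : typ (a.base c) ≠ 34)
    (hd : PrimeOrd (a'.base d)) (htd : typ (a'.base d) ≠ 34)
    (had : a.base d = 1 ∨ PrimeOrd (a.base d) ∧ typ (a.base d) = 34)
    (hac : a'.base c = 1 ∨ PrimeOrd (a'.base c) ∧ typ (a'.base c) = 34) : Mates a a' := by
  obtain ⟨u, hu, h1⟩ := hc.exists_good htc
  obtain ⟨w, hw, h2⟩ := hd.exists_good htd
  let g : Fin k → Equiv.Perm (Fin 6) := fun i => if i = c then u else w
  have hgc : g c = u := if_pos rfl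
  have hgd : g d = w := if_neg hcd.symm
  refine (h.initial (S := {c, d}) (g := g) (c := c) (by simp) (by rwa [hgc]) ?_).mates
    (h'.initial (c := d) (by simp) (by rwa [hgd]) ?_) (fun i => ?_) h.rotates h'.rotates
  · intro e he hec
    rw [Finset.mem_insert, Finset.mem_singleton] at he
    rw [he.resolve_left hec, hgc]
    exact inv3_ne_of_one_or_swap _ had (hc.conj u) h1
  · intro e he hed
    rw [Finset.mem_insert, Finset.mem_singleton] at he
    rw [he.resolve_right hed, hgd]
    exact inv3_ne_of_one_or_swap _ hac (hd.conj w) h2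
  · dsimp only [g]
    split_ifs <;> assumption

theorem IsBase.init_of_swap {a : Wr k} (h : IsBase a) {c d : Fin k} {d₀ d₁ : Equiv.Perm (Fin 6)}
    (hne : inv3 d₀ ≠ inv3 d₁) (hgen : closure {v, d₀, d₁} = ⊤)
    {g : Fin k → Equiv.Perm (Fin 6)} (hc : PrimeOrd (a.base c))
    (h0 : g c * a.base c * (g c)⁻¹ = d₀) (h1 : g d * a.base d * (g d)⁻¹ = d₁) :
    Init a 1 {c, d} g := by
  refine ⟨c, by simp, by simp [h.rot], h.thin ?_, ?_, ?_⟩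
  · rw [h.coord_eq]
    exact inv3_one_ne (hc.conj _).1
  · intro e he _ hec
    rw [Finset.mem_insert, Finset.mem_singleton] at he
    rw [he.resolve_left hec, h.coord_eq, h.coord_eq, h0, h1]
    exact hne.symm
  · rw [eq_top_iff, ← hgen]
    apply Subgroup.closure_mono
    rintro y (rfl | rfl | rfl)
    · exact Or.inl rfl
    · exact Or.inr ⟨c, by simp [h.rot], by rw [h.coord_eq, h0]⟩
    · exact Or.inr ⟨d, by simp [h.rot], by rw [h.coord_eq, h1]⟩

theorem IsBase.mates_of_mixed {a a' : Wr k} (h : IsBase a) (h' : IsBase a') {c d : Fin k}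
    (hcd : c ≠ d) (hc : PrimeOrd (a.base c)) (hd : PrimeOrd (a.base d))
    (hc' : PrimeOrd (a'.base c)) (hd' : PrimeOrd (a'.base d)) (htc : typ (a.base c) = 2)
    (htd : typ (a.base d) = 2) (htc' : typ (a'.base c) = 34) (htd' : typ (a'.base d) = 34) :
    Mates a a' := by
  obtain ⟨i₀, d₀, d₁, hne, hgen, hall⟩ := exists_two_conj
  obtain ⟨u, hu, h1, h2, h3⟩ := (hall _ _ hc hc' htc htc').1
  obtain ⟨w, hw, h4, h5⟩ := (hall _ _ hd hd' htd htd').2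
  let g : Fin k → Equiv.Perm (Fin 6) := fun i => if i = c then u else w
  have hgc : g c = u := if_pos rfl
  have hgd : g d = w := if_neg hcd.symm
  refine (h.initial (S := {c, d}) (g := g) (c := c) (by simp) (by rwa [hgc]) ?_).mates
    (h'.init_of_swap hne hgen hc' (by rwa [hgc]) (by rwa [hgd])) (fun i => ?_) h.rotates
    h'.rotates
  · intro e he hec
    rw [Finset.mem_insert, Finset.mem_singleton] at he
    rwa [he.resolve_left hec, hgc, hgd, h3]
  · dsimp only [g]
    split_ifs <;> assumption

theorem IsBase.mates_self (hk : 2 ≤ k) {a : Wr k} (h : IsBase a) : Mates a a := by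
  obtain ⟨c, hc⟩ := h.exists_prime
  have key : ∀ c, PrimeOrd (a.base c) → typ (a.base c) ≠ 34 → Mates a a := by
    intro c hc ht
    obtain ⟨u, hu, h1⟩ := hc.exists_good ht
    exact h.mates_of_compat h (c := c) ⟨u, hu, h1, h1⟩
  by_cases ht : typ (a.base c) = 34
  · have : Nontrivial (Fin k) := Fin.nontrivial_iff_two_le.2 hk
    obtain ⟨d, hdc⟩ := exists_ne c
    have hd := h.prime_of_sign (PrimeOrd.sign_of_typ ht) d
    by_cases ht' : typ (a.base d) = 34
    · obtain ⟨i₀, d₀, d₁, hne, hgen, hall⟩ := exists_two_conj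
      obtain ⟨u, hu, h1, -⟩ := (hall _ _ hc.out hc (hc.typ_out_of_swap ht) ht).1
      obtain ⟨w, hw, h2, -⟩ := (hall _ _ hd.out hd (hd.typ_out_of_swap ht') ht').2
      let g : Fin k → Equiv.Perm (Fin 6) := fun i => if i = c then u else w
      have hinit := h.init_of_swap hne hgen (g := g) (c := c) (d := d) hc
        (by dsimp only [g]; rwa [if_pos rfl]) (by dsimp only [g]; rwa [if_neg hdc])
      refine hinit.mates hinit (fun i => ?_) h.rotates h.rotates
      dsimp only [g]
      split_ifs <;> assumption
    · exact key d hd ht'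
  · exact key c hc ht

theorem IsOuter.rot_ne {a : Wr k} (h : IsOuter a) : a.rot ≠ 0 := fun h0 => h.rot (by simp [h0])

theorem IsBase.mates_outer {a a' : Wr k} (h : IsBase a) (h' : IsOuter a') {c : Fin k}
    (hc : PrimeOrd (a.base c)) (ht : typ (a.base c) ≠ 34) : Mates a a' := by
  obtain ⟨η, hη⟩ := exists_companion h'.mem
  obtain ⟨u, hu, hgood⟩ := hc.exists_good ht
  have hq := h'.rot_ne
  have hne : c - a'.rot ≠ c := by simpa using hq
  obtain ⟨w, hw, h1, h2⟩ := exists_even_avoiding (lt_of_lt_of_le (add_lt_add_of_lt_of_le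
    (h.thin (inv3_one_ne hgood.ne_one) (fun _ => u) (fun _ => hu) (c - a'.rot))
    (le_trans (hη.evenCard_right_le hq (g := fun _ => u) (fun _ => hu) (i := c - a'.rot) rfl
      (fun x => ¬Good x)) evenCard_not_good)) (by norm_num))
  let g := Function.update (fun _ : Fin k => u) (c - a'.rot) w
  have hg : ∀ i, sign (g i) = 1 := by
    intro i
    by_cases hi : i = c - a'.rot
    · subst hi; simpa [g] using hw
    · simpa [g, hi] using hu
  have hgc : g c = u := Function.update_of_ne hne.symm _ _
  refine (h.initial (S := {c, c - a'.rot}) (g := g) (c := c) (by simp) (by rwa [hgc]) ?_).mates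
    (hη.initial hq hg (c := c) (by simp) (by simp) (not_not.1 h2) ?_) hg h.rotates hη.rotates
  · intro e he hec
    rw [Finset.mem_insert, Finset.mem_singleton] at he
    rw [he.resolve_left hec, hgc]
    intro h3
    apply h1
    refine ⟨c - a'.rot, Or.inl rfl, ?_⟩
    rwa [h.coord_eq]
  · intro e he he' hec
    rw [Finset.mem_insert, Finset.mem_singleton] at he he'
    rw [he.resolve_left hec] at he'
    rcases he' with he' | he'
    · exact absurd (by rw [sub_sub, sub_eq_self] at he'; exact he') h'.rot
    · exact absurd (by simpa using he') hq

theorem IsOuter.mates_of_rot_eq {a a' : Wr k} (h : IsOuter a) (h' : IsOuter a')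
    (hr : a.rot = a'.rot) : Mates a a' := by
  obtain ⟨η, hη⟩ := exists_companion h.mem
  obtain ⟨η', hη'⟩ := exists_companion h'.mem
  have hq := h.rot_ne
  have hq' := h'.rot_ne
  have h1g : ∀ _ : Fin k, sign (1 : Equiv.Perm (Fin 6)) = 1 := fun _ => map_one _
  obtain ⟨w, hw, h1, h2⟩ := exists_even_avoiding (lt_of_le_of_lt (add_le_add
    (le_trans (hη.evenCard_right_le hq (g := fun _ => 1) h1g (i := -a.rot) (e := 0)
      (zero_sub _) (fun x => ¬Good x)) evenCard_not_good)
    (le_trans (hη'.evenCard_right_le hq' (g := fun _ => 1) h1g (i := -a.rot) (e := 0)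
      (by rw [hr, zero_sub]) (fun x => ¬Good x)) evenCard_not_good)) (by norm_num))
  let g := Function.update (fun _ : Fin k => (1 : Equiv.Perm (Fin 6))) (-a.rot) w
  have hg : ∀ i, sign (g i) = 1 := by
    intro i
    by_cases hi : i = -a.rot
    · subst hi; simpa [g] using hw
    · simp [g, hi]
  have hno : ∀ e ∈ ({0, -a.rot} : Finset (Fin k)), e - a.rot ∈ ({0, -a.rot} : Finset (Fin k)) →
      e ≠ 0 → False := by
    intro e he he' he0
    rw [Finset.mem_insert, Finset.mem_singleton] at he he'
    rw [he.resolve_left he0] at he'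
    rcases he' with he' | he'
    · exact h.rot (by rw [← neg_eq_zero, neg_add, ← sub_eq_add_neg, he'])
    · exact hq (by simpa using he')
  exact (hη.initial hq hg (S := {0, -a.rot}) (c := 0) (by simp) (by simp) (not_not.1 h1)
    fun e he he' he0 => (hno e he he' he0).elim).mates
    (hη'.initial hq' hg (c := 0) (by simp) (by simp [hr]) (not_not.1 h2)
    fun e he he' he0 => (hno e he (hr ▸ he') he0).elim) hg hη.rotates hη'.rotates

theorem IsOuter.mates_of_rot_ne {a a' : Wr k} (h : IsOuter a) (h' : IsOuter a')
    (h1 : a.rot ≠ a'.rot) (h2 : a.rot + a'.rot ≠ 0) (h3 : a.rot ≠ a'.rot + a'.rot) :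
    Mates a a' := by
  obtain ⟨η, hη⟩ := exists_companion h.mem
  obtain ⟨η', hη'⟩ := exists_companion h'.mem
  have hq := h.rot_ne
  have hq' := h'.rot_ne
  have h1g : ∀ _ : Fin k, sign (1 : Equiv.Perm (Fin 6)) = 1 := fun _ => map_one _
  have hupd : ∀ (f : Fin k → Equiv.Perm (Fin 6)) (j : Fin k) (w : Equiv.Perm (Fin 6)),
      (∀ i, sign (f i) = 1) → sign w = 1 → ∀ i, sign (Function.update f j w i) = 1 := by
    intro f j w hf hw i
    by_cases hi : i = j
    · subst hi; simpa using hw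
    · simpa [hi] using hf i
  obtain ⟨u, hu, hgood, -⟩ := exists_even_avoiding (Q := fun x => ¬Good x) (lt_of_le_of_lt
    (add_le_add (le_trans (hη.evenCard_right_le hq (g := fun _ => 1) h1g (i := -a.rot) (e := 0)
      (zero_sub _) (fun x => ¬Good x)) evenCard_not_good) evenCard_not_good) (by norm_num))
  rw [not_not] at hgood
  let f := Function.update (fun _ : Fin k => (1 : Equiv.Perm (Fin 6))) (-a.rot) u
  have hf : ∀ i, sign (f i) = 1 := hupd _ _ _ h1g hu
  obtain ⟨w, hw, h4, h5⟩ := exists_even_avoiding (lt_of_lt_of_le (add_lt_add_of_lt_of_le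
    (hη.thin hq hgood (hη.sign_coord hf 0) f hf (-a'.rot))
    (le_trans (hη'.evenCard_right_le hq' hf (i := -a'.rot) (e := 0) (zero_sub _)
      (fun x => ¬Good x)) evenCard_not_good)) (by norm_num))
  rw [not_not] at h5
  let g := Function.update f (-a'.rot) w
  have hg : ∀ i, sign (g i) = 1 := hupd _ _ _ hf hw
  have hcoord : coord a η g 0 = coord a η f 0 := by
    refine coord_congr (Function.update_of_ne (by simpa using hq') _ _)
      (Function.update_of_ne (by simpa using h1) _ _)
  have hS : ∀ e ∈ ({0, -a.rot, -a'.rot} : Finset (Fin k)), e ≠ 0 → e = -a.rot ∨ e = -a'.rot := by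
    intro e he he0
    simpa [he0] using he
  refine (hη.initial hq hg (S := {0, -a.rot, -a'.rot}) (c := 0) (by simp) (by simp)
    (by rwa [hcoord]) fun e he he' he0 => ?_).mates
    (hη'.initial hq' hg (c := 0) (by simp) (by simp) h5 fun e he he' he0 => ?_) hg hη.rotates
    hη'.rotates
  · rw [hcoord]
    intro h6
    apply h4
    rcases hS e he he0 with he | he
    · refine ⟨e, Or.inr ?_, h6⟩
      have h7 : e - a.rot ≠ 0 := by
        intro h8
        apply h.rot
        rw [he, ← neg_add', neg_eq_zero] at h8
        exact h8
      exact (hS _ he' h7).resolve_left fun h8 => hq (by simpa [he] using h8)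
    · exact ⟨e, Or.inl he, h6⟩
  · exfalso
    have h7 : e - a'.rot ≠ 0 := by
      intro h8
      rcases hS e he he0 with he | he
      · rw [he, ← neg_add', neg_eq_zero] at h8; exact h2 h8
      · rw [he, ← neg_add', neg_eq_zero] at h8; exact h'.rot h8
    rcases hS e he he0 with he | he <;> rcases hS _ he' h7 with h8 | h8 <;> rw [he] at h8
    · exact hq' (by simpa using h8)
    · rw [← neg_add', neg_inj] at h8; exact hq (by simpa using h8)
    · rw [← neg_add', neg_inj] at h8; exact h3 h8.symm
    · exact hq' (by simpa using h8)

/-- Some element of the group generates it with each of `a` and `a'`. -/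
def Gen (a a' : Wr k) : Prop :=
  ∃ w ∈ grp k v, closure {a, w} = grp k v ∧ closure {a', w} = grp k v

theorem Mates.gen {a a' : Wr k} (h : Mates a a') : Gen a a' := by
  obtain ⟨g, hg, h1, h2⟩ := h
  exact ⟨mate g, mate_mem hg, h1, h2⟩

theorem Gen.symm {a a' : Wr k} (h : Gen a a') : Gen a' a := by
  obtain ⟨w, hw, h1, h2⟩ := h
  exact ⟨w, hw, h2, h1⟩

theorem Gen.of_pow {a a' : Wr k} {n n' : ℕ} (h : Gen (a ^ n) (a' ^ n')) (ha : a ∈ grp k v)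
    (ha' : a' ∈ grp k v) : Gen a a' := by
  obtain ⟨w, hw, h1, h2⟩ := h
  exact ⟨w, hw, closure_pair_of_pow ha hw h1, closure_pair_of_pow ha' hw h2⟩

theorem closure_inv_pair {X : Type*} [Group X] (a w : X) : closure {a⁻¹, w} = closure {a, w} := by
  apply le_antisymm <;> rw [closure_le] <;> rintro _ (rfl | rfl)
  · exact inv_mem (subset_closure (by simp))
  · exact subset_closure (by simp)
  · exact inv_mem_iff.1 (subset_closure (by simp))
  · exact subset_closure (by simp)

theorem Gen.of_inv {a a' : Wr k} (h : Gen a a'⁻¹) : Gen a a' := by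
  obtain ⟨w, hw, h1, h2⟩ := h
  exact ⟨w, hw, h1, closure_inv_pair a' w ▸ h2⟩

theorem Gen.of_out {a a' : Wr k} (h : Gen (mapBase out a) (mapBase out a')) : Gen a a' := by
  obtain ⟨w, hw, h1, h2⟩ := h
  obtain ⟨w, rfl⟩ := (mapBase out).surjective w
  have hmap := map_mapBase (k := k) (f := out) sign_out (s := v)
  have hback : ∀ b : Wr k, closure {mapBase out b, mapBase out w} = grp k v →
      closure {b, w} = grp k v := by
    intro b hb
    apply map_injective (f := (mapBase (k := k) out).toMonoidHom) (mapBase out).injective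
    rw [MonoidHom.map_closure, Set.image_pair, hmap]
    exact hb
  refine ⟨w, ?_, hback a h1, hback a' h2⟩
  rw [← hmap] at hw
  obtain ⟨z, hz, h⟩ := hw
  exact (mapBase (k := k) out).injective h ▸ hz

theorem IsBase.out {a : Wr k} (h : IsBase a) : IsBase (mapBase out a) := by
  refine ⟨(mapBase_mem sign_out).2 h.mem, h.rot, fun i => ?_, ?_⟩
  · rw [mapBase_base]
    exact (h.prime i).imp (fun h => by rw [h, map_one]) PrimeOrd.out
  · obtain ⟨i, hi⟩ := h.ne
    exact ⟨i, by rwa [mapBase_base, Ne, map_eq_one_iff _ S6.out.injective]⟩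

theorem IsOuter.out {a : Wr k} (h : IsOuter a) : IsOuter (mapBase out a) :=
  ⟨(mapBase_mem sign_out).2 h.mem, h.rot⟩

theorem grp_one : grp 1 v = ⊤ := by
  rw [eq_top_iff]
  intro b _
  refine mem_grp_iff.2 ?_
  rcases Int.units_eq_one_or (sign (b.base 0)) with h | h
  · refine ⟨1, one_mem _, Subsingleton.elim _ _, fun i => ?_⟩
    rw [Subsingleton.elim i 0, h, one_base, map_one]
  · refine ⟨shift v, mem_zpowers _, Subsingleton.elim _ _, fun i => ?_⟩
    rw [Subsingleton.elim i 0, h, shift_base_zero, sign_v]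

theorem gen_of_subsingleton {a a' : Wr 1} (hw : ∃ w, closure {a.base 0, w} = ⊤ ∧
    closure {a'.base 0, w} = ⊤) : Gen a a' := by
  obtain ⟨w, h1, h2⟩ := hw
  let f : Equiv.Perm (Fin 6) →* Wr 1 := ofBase.comp (Pi.constMonoidHom (Fin 1) _)
  have hf : ∀ b : Wr 1, f (b.base 0) = b := fun b => by
    refine Wr.ext ?_ (Subsingleton.elim _ _)
    funext i
    rw [Subsingleton.elim i 0]
    rfl
  have hlift : ∀ b : Wr 1, closure {b.base 0, w} = ⊤ → closure {b, f w} = grp 1 v := by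
    intro b hb
    have := congrArg (Subgroup.map f) hb
    rwa [MonoidHom.map_closure, Set.image_pair, hf, map_top_of_surjective f fun b => ⟨_, hf b⟩,
      ← grp_one] at this
  exact ⟨f w, grp_one ▸ mem_top _, hlift a h1, hlift a' h2⟩

/-- The two coordinates are a transposition and a triple transposition. -/
def Mixed (x y : Equiv.Perm (Fin 6)) : Prop :=
  (typ x = 34 ∧ typ y = 2) ∨ (typ x = 2 ∧ typ y = 34)

theorem IsBase.gen_of_mixed {a a' : Wr k} (h : IsBase a) (h' : IsBase a') {c : Fin k}
    (hall : ∀ i, PrimeOrd (a.base i) → PrimeOrd (a'.base i) → Mixed (a.base i) (a'.base i))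
    (hc : PrimeOrd (a.base c)) (hc' : PrimeOrd (a'.base c)) (ht : typ (a.base c) = 2)
    (ht' : typ (a'.base c) = 34) : Gen a a' := by
  by_cases hk : k = 1
  · subst hk
    rw [Subsingleton.elim c 0] at *
    exact gen_of_subsingleton (exists_common_mate hc hc' ht ht')
  have : Nontrivial (Fin k) := Fin.nontrivial_iff_two_le.2 (by
    have := NeZero.ne k; omega)
  obtain ⟨d, hdc⟩ := exists_ne c
  have hd := h.prime_of_sign (hc.sign_of_typ_two ht) d
  have hd' := h'.prime_of_sign (PrimeOrd.sign_of_typ ht') d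
  rcases hall d hd hd' with ⟨h1, h2⟩ | ⟨h1, h2⟩
  · exact (h.mates_of_swap_or_one h' hdc.symm hc (by rw [ht]; decide) hd' (by rw [h2]; decide)
      (Or.inr ⟨hd, h1⟩) (Or.inr ⟨hc', ht'⟩)).gen
  · exact (h.mates_of_mixed h' hdc.symm hc hd hc' hd' ht h1 ht' h2).gen

theorem IsBase.gen {a a' : Wr k} (h : IsBase a) (h' : IsBase a') : Gen a a' := by
  by_cases hcompat : ∃ c, Compat (a.base c) (a'.base c)
  · obtain ⟨c, hc⟩ := hcompat
    exact (h.mates_of_compat h' hc).gen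
  by_cases hcompat' : ∃ c, Compat (S6.out (a.base c)) (S6.out (a'.base c))
  · obtain ⟨c, hc⟩ := hcompat'
    exact (h.out.mates_of_compat h'.out (c := c) (by rwa [mapBase_base, mapBase_base])).gen.of_out
  have hall : ∀ i, PrimeOrd (a.base i) → PrimeOrd (a'.base i) →
      Mixed (a.base i) (a'.base i) := fun i hi hi' =>
    ((compat_cases hi hi').resolve_left fun hn => hcompat ⟨i, hn⟩).resolve_left
      fun hn => hcompat' ⟨i, hn⟩
  by_cases hcommon : ∃ c, PrimeOrd (a.base c) ∧ PrimeOrd (a'.base c)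
  · obtain ⟨c, hc, hc'⟩ := hcommon
    rcases hall c hc hc' with ⟨h1, h2⟩ | ⟨h1, h2⟩
    · exact (h'.gen_of_mixed h (fun i hi hi' => (hall i hi' hi).symm.imp And.symm And.symm)
        hc' hc h2 h1).symm
    · exact h.gen_of_mixed h' hall hc hc' h1 h2
  obtain ⟨c, hc⟩ := h.exists_prime
  obtain ⟨d, hd⟩ := h'.exists_prime
  have hc1 : a'.base c = 1 := (h'.prime c).resolve_right fun hn => hcommon ⟨c, hc, hn⟩
  have hd1 : a.base d = 1 := (h.prime d).resolve_right fun hn => hcommon ⟨d, hn, hd⟩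
  refine (h.mates_of_swap_or_one h' ?_ hc ?_ hd ?_ (Or.inl hd1) (Or.inl hc1)).gen
  · rintro rfl
    exact hcommon ⟨c, hc, hd⟩
  · exact fun ht => (h.prime_of_sign (PrimeOrd.sign_of_typ ht) d).1 hd1
  · exact fun ht => (h'.prime_of_sign (PrimeOrd.sign_of_typ ht) c).1 hc1

theorem IsBase.gen_outer {a a' : Wr k} (h : IsBase a) (h' : IsOuter a') : Gen a a' := by
  obtain ⟨c, hc⟩ := h.exists_prime
  by_cases ht : typ (a.base c) = 34
  · refine (h.out.mates_outer h'.out (c := c) ?_ ?_).gen.of_out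
    · exact hc.out
    · rw [mapBase_base, hc.typ_out_of_swap ht]
      decide
  · exact (h.mates_outer h' hc ht).gen

theorem IsOuter.gen {a a' : Wr k} (h : IsOuter a) (h' : IsOuter a') : Gen a a' := by
  by_cases h1 : a.rot = a'.rot
  · exact (h.mates_of_rot_eq h' h1).gen
  by_cases h2 : a.rot + a'.rot = 0
  · refine (h.mates_of_rot_eq (a' := a'⁻¹) ⟨inv_mem h'.mem, ?_⟩ ?_).gen.of_inv
    · rw [inv_rot, ← neg_add, Ne, neg_eq_zero]
      exact h'.rot
    · rw [inv_rot]
      exact eq_neg_of_add_eq_zero_left h2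
  by_cases h3 : a.rot = a'.rot + a'.rot
  · refine (h'.mates_of_rot_ne h (Ne.symm h1) (by rwa [add_comm]) fun h4 => h2 ?_).gen.symm
    have h5 : (a'.rot + a'.rot + a'.rot) = 0 := by
      rw [h3] at h4
      have : a'.rot + 0 = a'.rot + (a'.rot + a'.rot + a'.rot) := by
        rw [add_zero, ← add_assoc, ← add_assoc, add_assoc (a'.rot + a'.rot)]; exact h4
      exact (add_left_cancel this).symm
    rw [h3, h5]
  · exact (h.mates_of_rot_ne h' h1 h2 h3).gen

/-- Any two nontrivial elements have a common mate. -/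
theorem gen_of_ne_one {a a' : Wr k} (ha : a ∈ grp k v) (ha' : a' ∈ grp k v) (h : a ≠ 1)
    (h' : a' ≠ 1) : Gen a a' := by
  obtain ⟨n, hn⟩ := exists_isBase_or_isOuter ha h
  obtain ⟨n', hn'⟩ := exists_isBase_or_isOuter ha' h'
  apply Gen.of_pow (n := n) (n' := n') _ ha ha'
  rcases hn with hn | hn <;> rcases hn' with hn' | hn'
  · exact hn.gen hn'
  · exact hn.gen_outer hn'
  · exact (hn'.gen_outer hn).symm
  · exact hn.gen hn'

/-- If `2 ≤ k` then every nontrivial element has a mate conjugate to `shift v`. -/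
theorem exists_mate (hk : 2 ≤ k) {a : Wr k} (ha : a ∈ grp k v) (h : a ≠ 1) :
    ∃ g : Fin k → Equiv.Perm (Fin 6), (∀ i, sign (g i) = 1) ∧
      closure {a, mate g} = grp k v := by
  obtain ⟨n, hn⟩ := exists_isBase_or_isOuter ha h
  have hm : Mates (a ^ n) (a ^ n) := by
    rcases hn with hn | hn
    · exact hn.mates_self hk
    · exact hn.mates_of_rot_eq hn rfl
  obtain ⟨g, hg, h1, -⟩ := hm
  exact ⟨g, hg, closure_pair_of_pow ha (mate_mem hg) h1⟩

end Wr

theorem closure_ne_top_of_even {x w : Equiv.Perm (Fin 6)} (hx : sign x = 1) (hw : sign w = 1) :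
    closure {x, w} ≠ ⊤ := by
  intro h
  have hle : closure {x, w} ≤ (sign (α := Fin 6)).ker := by
    rw [closure_le]
    rintro _ (rfl | rfl)
    exacts [hx, hw]
  rw [h] at hle
  have : sign v = 1 := hle (mem_top v)
  rw [sign_v] at this
  exact absurd this (by decide)

theorem exists_even_of_code (c : ℕ) (hc : mem c codes = true)
    (h1 : (Nat.beq (invParity c) 0 && !Nat.beq c idc) = true) :
    ∃ x : Equiv.Perm (Fin 6), enc x = c ∧ sign x = 1 ∧ x ≠ 1 := by
  obtain ⟨x, rfl⟩ := exists_enc_eq (mem_iff.1 hc)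
  rw [Bool.and_eq_true, Nat.beq_eq] at h1
  refine ⟨x, rfl, ?_, ?_⟩
  · rw [sign_eq, if_pos h1.1]
  · rintro rfl
    rw [enc_one] at h1
    exact absurd h1.2 (by decide)

/-- Three even permutations without a common mate. -/
theorem exists_three_no_mate : ∃ x : Fin 3 → Equiv.Perm (Fin 6),
    (∀ i, sign (x i) = 1 ∧ x i ≠ 1) ∧ ∀ w, ∃ i, closure {x i, w} ≠ ⊤ := by
  obtain ⟨x, hx, hxs, hx1⟩ := exists_even_of_code 152776 (by decide +kernel) (by decide +kernel)
  obtain ⟨y, hy, hys, hy1⟩ := exists_even_of_code 153168 (by decide +kernel) (by decide +kernel)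
  obtain ⟨z, hz, hzs, hz1⟩ := exists_even_of_code 152216 (by decide +kernel) (by decide +kernel)
  have hx' := enc_out (d := 152776) (by decide +kernel) hx
  have hy' := enc_out (d := 165460) (by decide +kernel) hy
  have hz' := enc_out (d := 17053) (by decide +kernel) hz
  refine ⟨![x, y, z], fun i => by fin_cases i <;> simp_all, fun w => ?_⟩
  rcases Int.units_eq_one_or (sign w) with hw | hw
  · exact ⟨0, closure_ne_top_of_even hxs hw⟩
  by_cases h6 : Six w
  · obtain ⟨c, hc, h⟩ := exists_closure_ne_top (l := [152776, 165460, 17053])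
      (by simp [obstructions]) (w := out w) (by rwa [sign_out]) h6.not_out
    simp only [List.mem_cons, List.not_mem_nil, or_false] at hc
    rcases hc with rfl | rfl | rfl
    · exact ⟨0, fun h' => h _ hx' (closure_out h')⟩
    · exact ⟨1, fun h' => h _ hy' (closure_out h')⟩
    · exact ⟨2, fun h' => h _ hz' (closure_out h')⟩
  · obtain ⟨c, hc, h⟩ := exists_closure_ne_top (l := [152776, 153168, 152216])
      (by simp [obstructions]) hw h6
    simp only [List.mem_cons, List.not_mem_nil, or_false] at hc
    rcases hc with rfl | rfl | rfl
    · exact ⟨0, h _ hx⟩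
    · exact ⟨1, h _ hy⟩
    · exact ⟨2, h _ hz⟩

/-- For every class there are two even permutations without a common mate in it. -/
theorem exists_two_no_mate (w : Equiv.Perm (Fin 6)) : ∃ x : Fin 2 → Equiv.Perm (Fin 6),
    (∀ i, sign (x i) = 1 ∧ x i ≠ 1) ∧ ∀ h, ∃ i, closure {x i, h * w * h⁻¹} ≠ ⊤ := by
  obtain ⟨x, hx, hxs, hx1⟩ := exists_even_of_code 181777 (by decide +kernel) (by decide +kernel)
  obtain ⟨y, hy, hys, hy1⟩ := exists_even_of_code 120968 (by decide +kernel) (by decide +kernel)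
  rcases Int.units_eq_one_or (sign w) with hw | hw
  · exact ⟨![x, y], fun i => by fin_cases i <;> simp_all,
      fun h => ⟨0, closure_ne_top_of_even hxs (by simp [hw])⟩⟩
  have key : ∀ u, sign u = -1 → ¬Six u → ∀ h, ∃ i, closure {![x, y] i, h * u * h⁻¹} ≠ ⊤ := by
    intro u hu h6 h
    obtain ⟨c, hc, h⟩ := exists_closure_ne_top (l := [181777, 120968])
      (by simp [obstructions]) (w := h * u * h⁻¹) (by simp [hu]) (by rwa [six_conj])
    simp only [List.mem_cons, List.not_mem_nil, or_false] at hc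
    rcases hc with rfl | rfl
    · exact ⟨0, h _ hx⟩
    · exact ⟨1, h _ hy⟩
  by_cases h6 : Six w
  · refine ⟨fun i => out.symm (![x, y] i), fun i => ⟨?_, ?_⟩, fun h => ?_⟩
    · rw [← sign_out, out.apply_symm_apply]
      fin_cases i <;> simp_all
    · rw [Ne, map_eq_one_iff _ out.symm.injective]
      fin_cases i <;> simp_all
    · obtain ⟨i, hi⟩ := key (out w) (by rwa [sign_out]) h6.not_out (out h)
      refine ⟨i, fun h' => hi ?_⟩
      have := closure_out h'
      rwa [out.apply_symm_apply, map_mul, map_mul, map_inv] at this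
  · exact ⟨![x, y], fun i => by fin_cases i <;> simp_all, key w hw h6⟩

/-- For every class there is a nontrivial permutation without a mate in it. -/
theorem exists_one_no_mate (w : Equiv.Perm (Fin 6)) :
    ∃ x : Equiv.Perm (Fin 6), x ≠ 1 ∧ ∀ h, closure {x, h * w * h⁻¹} ≠ ⊤ := by
  rcases Int.units_eq_one_or (sign w) with hw | hw
  · obtain ⟨x, hx⟩ : ∃ x : Equiv.Perm (Fin 6), sign x = 1 ∧ x ≠ 1 := by
      obtain ⟨x, -, hx⟩ := exists_even_of_code 181777 (by decide +kernel) (by decide +kernel)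
      exact ⟨x, hx⟩
    exact ⟨x, hx.2, fun h => closure_ne_top_of_even hx.1 (by simp [hw])⟩
  have key : ∀ u, sign u = -1 → ¬Six u → ∀ h, closure {Equiv.swap 0 1, h * u * h⁻¹} ≠ ⊤ := by
    intro u hu h6 h
    obtain ⟨c, hc, h⟩ := exists_closure_ne_top (l := [181889])
      (by simp [obstructions]) (w := h * u * h⁻¹) (by simp [hu]) (by rwa [six_conj])
    rw [List.mem_singleton.1 hc] at h
    exact h _ (by decide +kernel)
  by_cases h6 : Six w
  · refine ⟨out.symm (Equiv.swap 0 1), ?_, fun h h' => ?_⟩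
    · rw [Ne, map_eq_one_iff _ out.symm.injective]
      decide
    · apply key (out w) (by rwa [sign_out]) h6.not_out (out h)
      have := closure_out h'
      rwa [out.apply_symm_apply, map_mul, map_mul, map_inv] at this
  · exact ⟨Equiv.swap 0 1, by decide, key w hw h6⟩

namespace Wr

variable {k : ℕ} [NeZero k]

theorem zsmul_rot_of_closure {a w : Wr k} (ha : a.rot = 0) (h : closure {a, w} = grp k v)
    (q : Fin k) : ∃ j : ℤ, j • w.rot = q := by
  have hle : closure {a, w} ≤ (zpowers (Multiplicative.ofAdd w.rot)).comap rotHom := by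
    rw [closure_le]
    rintro b (rfl | rfl)
    · show Multiplicative.ofAdd b.rot ∈ zpowers (Multiplicative.ofAdd w.rot)
      rw [ha, ofAdd_zero]
      exact one_mem _
    · exact mem_zpowers _
  obtain ⟨j, hj⟩ := mem_zpowers_iff.1 (hle (h ▸ pow_mem (shift_mem (k := k)) q.val :
    shift v ^ q.val ∈ closure {a, w}))
  refine ⟨j, ?_⟩
  have h1 : j • w.rot = ((shift v : Wr k) ^ q.val).rot := hj
  rw [h1, pow_rot, shift_rot, val_nsmul_one]

theorem dvd_of_zsmul_rot {a w : Wr k} (ha : a.rot = 0) (h : closure {a, w} = grp k v) {j : ℤ}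
    (hj : j • w.rot = 0) : (k : ℤ) ∣ j := by
  obtain ⟨i, hi⟩ := zsmul_rot_of_closure ha h 1
  apply dvd_of_zsmul_one
  rw [← hi, smul_comm, hj, smul_zero]

theorem base_mul_of_rot {a b : Wr k} (h : a.rot = 0) (i : Fin k) :
    (a * b).base i = a.base i * b.base i := by
  rw [mul_base, h, sub_zero]

theorem base_zpow_of_rot {a : Wr k} (h : a.rot = 0) (j : ℤ) (i : Fin k) :
    (a ^ j).base i = a.base i ^ j := by
  rw [eq_ofBase h, ← map_zpow]
  rfl

/-- If an element supported at one coordinate has the mate `w`, then its nontrivial coordinate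
generates `S₆` with the corresponding coordinate of `w ^ k`. -/
theorem closure_coord_eq_top {x : Equiv.Perm (Fin 6)} {w : Wr k}
    (h : closure {ofBase (Pi.mulSingle 0 x), w} = grp k v) :
    closure {x, (w ^ k).base 0} = ⊤ := by
  set a : Wr k := ofBase (Pi.mulSingle 0 x) with ha
  set Q := closure {x, (w ^ k).base 0} with hQ
  have hpow : ∀ j : ℤ, (w ^ j).rot = 0 → (w ^ j).base 0 ∈ Q := by
    intro j hj
    rw [zpow_rot] at hj
    obtain ⟨l, rfl⟩ := dvd_of_zsmul_rot rfl h hj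
    rw [zpow_mul, zpow_natCast, base_zpow_of_rot (by rw [pow_rot, card_nsmul_fin])]
    exact zpow_mem (subset_closure (by simp)) l
  let L : Subgroup (Wr k) :=
    { carrier := {b | ∀ m n : ℤ, (w ^ m * b * w ^ n).rot = 0 → (w ^ m * b * w ^ n).base 0 ∈ Q}
      one_mem' := fun m n hmn => by
        rw [mul_one, ← zpow_add] at hmn ⊢
        exact hpow _ hmn
      mul_mem' := fun {b b'} hb hb' m n hmn => by
        obtain ⟨j, hj⟩ := zsmul_rot_of_closure rfl h (-(w ^ m * b).rot)
        have h1 : (w ^ m * b * w ^ j).rot = 0 := by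
          rw [mul_rot, zpow_rot, hj, add_neg_cancel]
        have h2 : w ^ m * (b * b') * w ^ n = (w ^ m * b * w ^ j) * (w ^ (-j) * b' * w ^ n) := by
          group
        rw [h2] at hmn ⊢
        rw [base_mul_of_rot h1]
        rw [mul_rot, h1, zero_add] at hmn
        exact mul_mem (hb m j h1) (hb' (-j) n hmn)
      inv_mem' := fun {b} hb m n hmn => by
        have h1 : w ^ m * b⁻¹ * w ^ n = (w ^ (-n) * b * w ^ (-m))⁻¹ := by group
        rw [h1] at hmn ⊢
        rw [inv_rot, neg_eq_zero] at hmn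
        rw [inv_base, hmn, add_zero]
        exact inv_mem (hb _ _ hmn) }
  have hL : grp k v ≤ L := by
    rw [← h, closure_le]
    rintro b (rfl | rfl)
    · intro m n hmn
      have h1 : w ^ m * a * w ^ n = (w ^ m * a * (w ^ m)⁻¹) * w ^ (m + n) := by group
      have h2 : (w ^ m * a * (w ^ m)⁻¹).rot = 0 := by rw [ha, conj_ofBase]; rfl
      rw [h1] at hmn ⊢
      rw [mul_rot, h2, zero_add] at hmn
      rw [base_mul_of_rot h2]
      refine mul_mem ?_ (hpow _ hmn)
      rw [ha, conj_ofBase, ofBase_base]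
      by_cases hr : (w ^ m).rot = 0
      · rw [hr, sub_zero, Pi.mulSingle_eq_same]
        exact mul_mem (mul_mem (hpow m hr) (subset_closure (by simp))) (inv_mem (hpow m hr))
      · rw [Pi.mulSingle_eq_of_ne (by simpa using hr), mul_one, mul_inv_cancel]
        exact one_mem _
    · intro m n hmn
      have h1 : b ^ m * b * b ^ n = b ^ (m + 1 + n) := by group
      rw [h1] at hmn ⊢
      exact hpow _ hmn
  have hQmem : ∀ β : Fin k → Equiv.Perm (Fin 6), ofBase β ∈ grp k v → β 0 ∈ Q := by
    intro β hβ
    have := hL hβ 0 0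
    rw [zpow_zero, one_mul, mul_one] at this
    exact this rfl
  refine eq_top_of_sign (s := v) (fun y hy => ?_) sign_v ?_
  · have := hQmem (fun _ => y) (evenBase_le (ofBase_mem_evenBase.2 fun _ => hy))
    exact this
  · exact hQmem (fun _ => v) (shift_pow (k := k) v ▸ pow_mem shift_mem k)

theorem single_mem {x : Equiv.Perm (Fin 6)} (hx : sign x = 1) :
    (ofBase (Pi.mulSingle 0 x) : Wr k) ∈ grp k v := by
  refine evenBase_le (ofBase_mem_evenBase.2 fun i => ?_)
  by_cases hi : i = 0
  · subst hi; simpa using hx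
  · simp [Pi.mulSingle_eq_of_ne hi]

theorem single_ne_one {x : Equiv.Perm (Fin 6)} (hx : x ≠ 1) :
    (ofBase (Pi.mulSingle 0 x) : Wr k) ≠ 1 := by
  intro h
  have := congrArg (fun b : Wr k => b.base 0) h
  simp only [ofBase_base, Pi.mulSingle_eq_same] at this
  exact hx this

/-- A conjugate of `c` by `g` whose rotation generates is a conjugate by an element without
rotation. -/
theorem exists_conj_base {a c g : Wr k} (ha : a.rot = 0)
    (h : closure {a, g⁻¹ * c * g} = grp k v) :
    ∃ u : Equiv.Perm (Fin 6), ((g⁻¹ * c * g) ^ k).base 0 = u * (c ^ k).base 0 * u⁻¹ := by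
  have hr : (g⁻¹ * c * g).rot = c.rot := by
    rw [mul_rot, mul_rot, inv_rot, neg_add_eq_sub, sub_add_cancel]
  obtain ⟨m, hm⟩ := zsmul_rot_of_closure ha h (-g.rot)
  rw [hr] at hm
  have h0 : (c ^ m * g).rot = 0 := by rw [mul_rot, zpow_rot, hm, neg_add_cancel]
  have hc : (c ^ k).rot = 0 := by rw [pow_rot, card_nsmul_fin]
  refine ⟨((c ^ m * g).base 0)⁻¹, ?_⟩
  have h1 : (g⁻¹ * c * g) ^ k = (c ^ m * g)⁻¹ * c ^ k * (c ^ m * g) := by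
    have h2 : (g⁻¹ * c * g) ^ k = g⁻¹ * c ^ k * g := by
      simpa using conj_pow (i := k) (a := g⁻¹) (b := c)
    rw [h2, mul_inv_rev, ← zpow_natCast c k]
    group
  have h3 : (c ^ m * g)⁻¹.rot = 0 := by rw [inv_rot, h0, neg_zero]
  rw [h1, base_mul_of_rot (by rw [mul_rot, h3, hc, add_zero]), base_mul_of_rot h3, inv_base, h0,
    add_zero, inv_inv]

end Wr

section Transport

variable {X Y : Type*} [Group X] [Group Y] {f : X →* Y} {M : Subgroup X}

theorem closure_map_pair (hf : Function.Injective f) (a w : X) :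
    closure {f a, f w} = M.map f ↔ closure {a, w} = M := by
  rw [← Set.image_pair, ← MonoidHom.map_closure, (map_injective hf).eq_iff]

theorem subSpreadGE_map (hf : Function.Injective f) (n : ℕ) :
    SubSpreadGE (M.map f) n ↔ SubSpreadGE M n := by
  constructor
  · intro h a ha h1
    obtain ⟨w, ⟨w, hw, rfl⟩, h2⟩ := h (fun i => f (a i)) (fun i => mem_map_of_mem f (ha i))
      fun i => by rw [Ne, map_eq_one_iff f hf]; exact h1 i
    exact ⟨w, hw, fun i => (closure_map_pair hf _ _).1 (h2 i)⟩
  · intro h a ha h1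
    choose b hb hba using ha
    obtain rfl : (fun i => f (b i)) = a := funext hba
    obtain ⟨w, hw, h2⟩ := h b hb fun i hi => h1 i (by show f (b i) = 1; rw [hi, map_one])
    exact ⟨f w, mem_map_of_mem f hw, fun i => (closure_map_pair hf _ _).2 (h2 i)⟩

theorem subUniformSpreadGE_map (hf : Function.Injective f) (n : ℕ) :
    SubUniformSpreadGE (M.map f) n ↔ SubUniformSpreadGE M n := by
  constructor
  · rintro ⟨_, ⟨c, hc, rfl⟩, h⟩
    refine ⟨c, hc, fun a ha h1 => ?_⟩
    obtain ⟨_, ⟨_, ⟨g, hg, rfl⟩, rfl⟩, h2⟩ := h (fun i => f (a i))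
      (fun i => mem_map_of_mem f (ha i)) fun i => by rw [Ne, map_eq_one_iff f hf]; exact h1 i
    refine ⟨_, ⟨g, hg, rfl⟩, fun i => (closure_map_pair hf _ _).1 ?_⟩
    rw [map_mul, map_mul, map_inv]
    exact h2 i
  · rintro ⟨c, hc, h⟩
    refine ⟨f c, mem_map_of_mem f hc, fun a ha h1 => ?_⟩
    choose b hb hba using ha
    obtain rfl : (fun i => f (b i)) = a := funext hba
    obtain ⟨_, ⟨g, hg, rfl⟩, h2⟩ := h b hb fun i hi => h1 i (by show f (b i) = 1; rw [hi, map_one])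
    refine ⟨_, ⟨f g, mem_map_of_mem f hg, rfl⟩, fun i => ?_⟩
    rw [← map_inv, ← map_mul, ← map_mul]
    exact (closure_map_pair hf _ _).2 (h2 i)

end Transport

namespace Wr

variable {k : ℕ} [NeZero k]

theorem subSpreadGE_two : SubSpreadGE (grp k v) 2 := by
  intro a ha h1
  obtain ⟨w, hw, h2, h3⟩ := gen_of_ne_one (ha 0) (ha 1) (h1 0) (h1 1)
  exact ⟨w, hw, Fin.forall_fin_two.2 ⟨h2, h3⟩⟩

theorem not_subSpreadGE_three : ¬SubSpreadGE (grp k v) 3 := by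
  intro h
  obtain ⟨x, hx, hno⟩ := exists_three_no_mate
  obtain ⟨w, -, h2⟩ := h (fun i => ofBase (Pi.mulSingle 0 (x i))) (fun i => single_mem (hx i).1)
    fun i => single_ne_one (hx i).2
  obtain ⟨i, hi⟩ := hno ((w ^ k).base 0)
  exact hi (closure_coord_eq_top (h2 i))

theorem not_subUniformSpreadGE_one (hk : k = 1) : ¬SubUniformSpreadGE (grp k v) 1 := by
  subst hk
  rintro ⟨c, -, h⟩
  obtain ⟨x, hx, hno⟩ := exists_one_no_mate ((c ^ 1).base 0)
  obtain ⟨_, ⟨g, -, rfl⟩, h2⟩ := h (fun _ => ofBase (Pi.mulSingle 0 x))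
    (fun _ => grp_one ▸ mem_top _) fun _ => single_ne_one hx
  obtain ⟨u, hu⟩ := exists_conj_base rfl (h2 0)
  exact hno u (hu ▸ closure_coord_eq_top (h2 0))

theorem subUniformSpreadGE_one (hk : 2 ≤ k) : SubUniformSpreadGE (grp k v) 1 := by
  refine ⟨shift v, shift_mem, fun a ha h1 => ?_⟩
  obtain ⟨g, hg, h⟩ := exists_mate hk (ha 0) (h1 0)
  refine ⟨mate g, ⟨ofBase g, evenBase_le (ofBase_mem_evenBase.2 hg), rfl⟩, fun i => ?_⟩
  rwa [Subsingleton.elim i 0]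

theorem not_subUniformSpreadGE_two : ¬SubUniformSpreadGE (grp k v) 2 := by
  rintro ⟨c, -, h⟩
  obtain ⟨x, hx, hno⟩ := exists_two_no_mate ((c ^ k).base 0)
  obtain ⟨_, ⟨g, -, rfl⟩, h2⟩ := h (fun i => ofBase (Pi.mulSingle 0 (x i)))
    (fun i => single_mem (hx i).1) fun i => single_ne_one (hx i).2
  obtain ⟨u, hu⟩ := exists_conj_base rfl (h2 0)
  obtain ⟨i, hi⟩ := hno u
  exact hi (hu ▸ closure_coord_eq_top (h2 i))

/-- The action of the wreath product on a power of `T` given by an action of `S₆` on `T`. -/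
def action {T : Type*} [Group T] (c : Equiv.Perm (Fin 6) →* MulAut T) :
    Wr k →* MulAut (Fin k → T) where
  toFun a :=
    { toFun := fun t i => c (a.base i) (t (i - a.rot))
      invFun := fun t i => c (a⁻¹.base i) (t (i - a⁻¹.rot))
      left_inv := fun t => by
        funext i
        show c (a⁻¹.base i) (c (a.base (i - a⁻¹.rot)) (t (i - a⁻¹.rot - a.rot))) = t i
        rw [← MulAut.mul_apply, ← map_mul, inv_rot, inv_base]
        simp
      right_inv := fun t => by
        funext i
        show c (a.base i) (c (a⁻¹.base (i - a.rot)) (t (i - a.rot - a⁻¹.rot))) = t i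
        rw [← MulAut.mul_apply, ← map_mul, inv_rot, inv_base]
        simp
      map_mul' := fun t u => by
        funext i
        exact map_mul _ _ _ }
  map_one' := by
    ext t i
    show c ((1 : Wr k).base i) (t (i - (1 : Wr k).rot)) = t i
    rw [one_base, one_rot, map_one, sub_zero, MulAut.one_apply]
  map_mul' a b := by
    ext t i
    show c ((a * b).base i) (t (i - (a * b).rot)) =
      c (a.base i) (c (b.base (i - a.rot)) (t (i - a.rot - b.rot)))
    rw [mul_base, mul_rot, map_mul, MulAut.mul_apply, sub_sub]

theorem action_apply {T : Type*} [Group T] (c : Equiv.Perm (Fin 6) →* MulAut T) (a : Wr k)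
    (t : Fin k → T) (i : Fin k) : action c a t i = c (a.base i) (t (i - a.rot)) := rfl

theorem action_injective {T : Type*} [Group T] [Nontrivial T]
    {c : Equiv.Perm (Fin 6) →* MulAut T} (hc : Function.Injective c) :
    Function.Injective (action (k := k) c) := by
  rw [injective_iff_map_eq_one]
  intro a ha
  have h : ∀ (t : Fin k → T) i, c (a.base i) (t (i - a.rot)) = t i := fun t i => by
    rw [← action_apply, ha, MulAut.one_apply]
  have hr : a.rot = 0 := by
    obtain ⟨t, ht⟩ := exists_ne (1 : T)
    by_contra hr
    have := h (Pi.mulSingle 0 t) 0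
    rw [Pi.mulSingle_eq_of_ne (by simpa using hr), map_one, Pi.mulSingle_eq_same] at this
    exact ht this.symm
  refine Wr.ext (funext fun i => (injective_iff_map_eq_one c).1 hc _ ?_) hr
  ext t
  have := h (fun _ => t) i
  rw [this, MulAut.one_apply]

/-- If `c` maps the even permutations onto the inner automorphisms then `action c` maps the group
onto the group generated by the inner automorphisms and the image of `shift s`. -/
theorem map_action {T : Type*} [Group T] {c : Equiv.Perm (Fin 6) →* MulAut T}
    (h1 : ∀ σ, sign σ = 1 → ∃ t, c σ = MulAut.conj t)
    (h2 : ∀ t, ∃ σ, sign σ = 1 ∧ c σ = MulAut.conj t) (s : Equiv.Perm (Fin 6)) :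
    (grp k s).map (action c) =
      (MulAut.conj : (Fin k → T) →* MulAut (Fin k → T)).range ⊔ zpowers (action c (shift s)) := by
  have heven : evenBase.map (action c) =
      (MulAut.conj : (Fin k → T) →* MulAut (Fin k → T)).range := by
    have hact : ∀ (σ : Fin k → Equiv.Perm (Fin 6)) (t : Fin k → T),
        (∀ i, c (σ i) = MulAut.conj (t i)) → action c (ofBase σ) = MulAut.conj t := by
      intro σ t h
      ext u i
      rw [action_apply, ofBase_base, ofBase_rot, sub_zero, h]
      rfl
    ext z
    constructor
    · rintro ⟨a, ha, rfl⟩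
      choose t ht using fun i => h1 (a.base i) (ha.2 i)
      refine ⟨t, ?_⟩
      rw [eq_ofBase ha.1, hact _ _ ht]
    · rintro ⟨t, rfl⟩
      choose σ hσ ht using fun i => h2 (t i)
      exact ⟨ofBase σ, ofBase_mem_evenBase.2 hσ, hact _ _ ht⟩
  rw [grp, Subgroup.map_sup, heven, MonoidHom.map_zpowers]

end Wr

theorem conj_alternating_injective :
    Function.Injective (MulAut.conj : alternatingGroup (Fin 6) →* _) := by
  rw [injective_iff_map_eq_one]
  intro t ht
  by_contra h1
  obtain ⟨d, hd, hne⟩ := exists_not_commute (x := (t : Equiv.Perm (Fin 6))) (by simpa using h1)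
  apply hne
  have h : (t : Equiv.Perm (Fin 6)) * d * (t : Equiv.Perm (Fin 6))⁻¹ = d :=
    congrArg (fun f : MulAut (alternatingGroup (Fin 6)) =>
      (f ⟨d, mem_alternatingGroup.2 hd⟩ : Equiv.Perm (Fin 6))) ht
  rwa [mul_inv_eq_iff_eq_mul] at h

/-- An isomorphism from an overgroup of the inner automorphisms of `A₆` to `S₆` maps the inner
automorphisms onto the even permutations. -/
theorem sign_eq_one_iff {A : Subgroup (MulAut (alternatingGroup (Fin 6)))}
    (hA : (MulAut.conj : alternatingGroup (Fin 6) →* _).range ≤ A)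
    (e : A ≃* Equiv.Perm (Fin 6)) (a : A) :
    sign (e a) = 1 ↔ ∃ t, (a : MulAut (alternatingGroup (Fin 6))) = MulAut.conj t := by
  let j : alternatingGroup (Fin 6) →* Equiv.Perm (Fin 6) :=
    e.toMonoidHom.comp (MulAut.conj.codRestrict A fun t => hA ⟨t, rfl⟩)
  have hj : Function.Injective j := e.injective.comp fun t u h =>
    conj_alternating_injective (congrArg Subtype.val h)
  have hcard : Nat.card j.range = Nat.card (alternatingGroup (Fin 6)) :=
    (Nat.card_congr (MonoidHom.ofInjective hj).toEquiv).symm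
  have hindex : j.range.index = 2 := by
    have h1 := card_mul_index j.range
    have h2 := card_mul_index (alternatingGroup (Fin 6))
    rw [alternatingGroup.index_eq_two] at h2
    rw [hcard] at h1
    exact Nat.eq_of_mul_eq_mul_left Nat.card_pos (h1.trans h2.symm)
  have hmem : sign (e a) = 1 ↔ e a ∈ j.range := by
    rw [eq_alternatingGroup_of_index_eq_two hindex, mem_alternatingGroup]
  rw [hmem]
  constructor
  · rintro ⟨t, ht⟩
    exact ⟨t, congrArg Subtype.val (e.injective ht).symm⟩
  · rintro ⟨t, ht⟩
    exact ⟨t, congrArg e (Subtype.ext ht.symm)⟩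

end S6

/-- Let `T = Alt₆` and let `y ∈ Aut(T)` be such that `A = ⟨Inn(T), y⟩` is the
copy of `Sym₆` inside `Aut(Alt₆)`. Let `N = T^k`, let `x ∈ Aut(N)` be given by
`x(t₁, …, t_k) = (y(t_k), t₁, …, t_{k-1})` and let `G = ⟨N, x⟩ ≤ Aut(N)`.
Then `s(G) = 2`, and `u(G) = 0` if `k = 1` while `u(G) = 1` if `k ≥ 2`. -/
theorem sym6_case (k : ℕ) [NeZero k]
    (y : MulAut ↥(alternatingGroup (Fin 6)))
    (A : Subgroup (MulAut ↥(alternatingGroup (Fin 6))))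
    (hA : A = (MulAut.conj :
        ↥(alternatingGroup (Fin 6)) →* MulAut ↥(alternatingGroup (Fin 6))).range ⊔
      Subgroup.zpowers y)
    (hAS6 : Nonempty (↥A ≃* Equiv.Perm (Fin 6)))
    (x : MulAut (Fin k → ↥(alternatingGroup (Fin 6))))
    (hx : ∀ (f : Fin k → ↥(alternatingGroup (Fin 6))) (i : Fin k),
      x f i = if i = 0 then y (f (i - 1)) else f (i - 1))
    (G : Subgroup (MulAut (Fin k → ↥(alternatingGroup (Fin 6)))))
    (hG : G = (MulAut.conj : (Fin k → ↥(alternatingGroup (Fin 6))) →*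
        MulAut (Fin k → ↥(alternatingGroup (Fin 6)))).range ⊔ Subgroup.zpowers x) :
    (SubSpreadGE G 2 ∧ ¬ SubSpreadGE G 3) ∧
    (k = 1 → ¬ SubUniformSpreadGE G 1) ∧
    (2 ≤ k → SubUniformSpreadGE G 1 ∧ ¬ SubUniformSpreadGE G 2) := by
  obtain ⟨e⟩ := hAS6
  have hle : (MulAut.conj : alternatingGroup (Fin 6) →* _).range ≤ A := hA ▸ le_sup_left
  have hyA : y ∈ A := hA ▸ (le_sup_right (a := MonoidHom.range _)) (Subgroup.mem_zpowers y)
  have hsign := S6.sign_eq_one_iff hle e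
  let c : Equiv.Perm (Fin 6) →* MulAut (alternatingGroup (Fin 6)) :=
    A.subtype.comp e.symm.toMonoidHom
  have hc : Function.Injective c := Subtype.val_injective.comp e.symm.injective
  have hce : ∀ a : A, c (e a) = a := fun a => congrArg Subtype.val (e.symm_apply_apply a)
  have h1 : ∀ σ, Equiv.Perm.sign σ = 1 → ∃ t, c σ = MulAut.conj t := by
    intro σ hσ
    obtain ⟨a, rfl⟩ := e.surjective σ
    rw [hce]
    exact (hsign a).1 hσ
  have h2 : ∀ t, ∃ σ, Equiv.Perm.sign σ = 1 ∧ c σ = MulAut.conj t := by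
    intro t
    let a : A := ⟨MulAut.conj t, hle ⟨t, rfl⟩⟩
    exact ⟨e a, (hsign a).2 ⟨t, rfl⟩, hce a⟩
  let s := e ⟨y, hyA⟩
  have hs : Equiv.Perm.sign s = Equiv.Perm.sign S6.v := by
    rw [S6.sign_v]
    refine (Int.units_eq_one_or _).resolve_left fun h => ?_
    obtain ⟨t, ht⟩ := (hsign _).1 h
    have hA' : A ≤ (MulAut.conj : alternatingGroup (Fin 6) →* _).range := by
      rw [hA, sup_le_iff, Subgroup.zpowers_le]
      exact ⟨le_rfl, t, ht.symm⟩
    obtain ⟨a, ha⟩ := e.surjective S6.v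
    obtain ⟨u, hu⟩ := hA' a.2
    have := (hsign a).2 ⟨u, hu.symm⟩
    rw [ha, S6.sign_v] at this
    exact absurd this (by decide)
  have hshift : S6.Wr.action c (S6.Wr.shift s) = x := by
    ext1 t
    funext i
    rw [hx, S6.Wr.action_apply, S6.Wr.shift_rot]
    split_ifs with hi
    · rw [hi, S6.Wr.shift_base_zero, hce]
    · rw [S6.Wr.shift_base_of_ne s hi, map_one, MulAut.one_apply]
  have hmap : G = (S6.Wr.grp k S6.v).map (S6.Wr.action c) := by
    rw [← S6.Wr.grp_eq hs, S6.Wr.map_action h1 h2, hshift, hG]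
  have : Nontrivial (alternatingGroup (Fin 6)) := inferInstance
  have hinj := S6.Wr.action_injective (k := k) hc
  rw [hmap]
  simp only [S6.subSpreadGE_map hinj, S6.subUniformSpreadGE_map hinj]
  exact ⟨⟨S6.Wr.subSpreadGE_two, S6.Wr.not_subSpreadGE_three⟩,
    S6.Wr.not_subUniformSpreadGE_one,
    fun hk => ⟨S6.Wr.subUniformSpreadGE_one hk, S6.Wr.not_subUniformSpreadGE_two⟩⟩
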